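/- arXiv:2204.03221 — 4 statements merged into one kernel-verified Lean document; each statement's English description precedes it below -/
import Mathlib

section
/- Let R, C, μ > 0 and let n ≥ 1 be an integer with Rμ/C ≥ n + 1. Then the social benefit rate function f_n is strictly concave on the interval [0, 1]. -/
/-- The social benefit rate function `f_n` of Naor's observable M/M/1 queue. -/
noncomputable def socialRate (R C μ : ℝ) (n : ℕ) (ρ : ℝ) : ℝ :=
  if ρ = 1 then R * μ * ((n : ℝ) / ((n : ℝ) + 1)) - C * ((n : ℝ) / 2)
  else R * μ * (ρ * (1 - ρ ^ n) / (1 - ρ ^ (n + 1)))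
      - C * (ρ / (1 - ρ) - ((n : ℝ) + 1) * ρ ^ (n + 1) / (1 - ρ ^ (n + 1)))

open Set

lemma pos_of_hasDerivAt_neg {f f' : ℝ → ℝ} (hc : ContinuousOn f (Ioc 0 1))
    (hf : ∀ x ∈ Ioo (0 : ℝ) 1, HasDerivAt f (f' x) x) (hneg : ∀ x ∈ Ioo (0 : ℝ) 1, f' x < 0)
    (h1 : f 1 = 0) : ∀ x ∈ Ioo (0 : ℝ) 1, 0 < f x := by
  intro x hx
  have hanti : StrictAntiOn f (Ioc 0 1) := by
    refine strictAntiOn_of_deriv_neg (convex_Ioc 0 1) hc fun y hy => ?_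
    rw [interior_Ioc] at hy
    rw [(hf y hy).deriv]
    exact hneg y hy
  simpa [h1] using hanti ⟨hx.1, hx.2.le⟩ ⟨one_pos, le_rfl⟩ hx.2

lemma pos_of_hasDerivAt_hasDerivAt_pos {f f' f'' : ℝ → ℝ} (hf : ∀ x, HasDerivAt f (f' x) x)
    (hf' : ∀ x, HasDerivAt f' (f'' x) x) (hpos : ∀ x ∈ Ioo (0 : ℝ) 1, 0 < f'' x)
    (h1 : f 1 = 0) (h1' : f' 1 = 0) : ∀ x ∈ Ioo (0 : ℝ) 1, 0 < f x := by
  refine pos_of_hasDerivAt_neg (fun x _ => (hf x).continuousAt.continuousWithinAt)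
    (fun x _ => hf x) (fun x hx => ?_) h1
  have := pos_of_hasDerivAt_neg (f := fun x => -f' x) (f' := fun x => -f'' x)
    (fun x _ => (hf' x).neg.continuousAt.continuousWithinAt) (fun x _ => (hf' x).neg)
    (fun x hx => neg_neg_of_pos (hpos x hx)) (by simp [h1']) x hx
  simpa using this

/-- Positivity of the numerator of the second derivative of `(1 - x) / (1 - x ^ (k + 2))`. -/
lemma inv_geom_numerator_pos (k : ℕ) : ∀ x ∈ Ioo (0 : ℝ) 1,
    0 < ((k : ℝ) + 1) - (k + 3) * x + (k + 3) * x ^ (k + 2) - (k + 1) * x ^ (k + 3) := by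
  refine pos_of_hasDerivAt_hasDerivAt_pos
    (f' := fun x => -((k : ℝ) + 3) + (k + 3) * (k + 2) * x ^ (k + 1)
      - (k + 1) * (k + 3) * x ^ (k + 2))
    (f'' := fun x => ((k : ℝ) + 3) * (k + 2) * (k + 1) * x ^ k * (1 - x)) ?_ ?_ ?_ ?_ ?_
  · intro x
    refine (((((hasDerivAt_id' x).const_mul ((k : ℝ) + 3)).const_sub ((k : ℝ) + 1)).add
      ((hasDerivAt_pow (k + 2) x).const_mul ((k : ℝ) + 3))).sub
      ((hasDerivAt_pow (k + 3) x).const_mul ((k : ℝ) + 1))).congr_deriv ?_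
    push_cast [Nat.add_succ_sub_one]
    ring
  · intro x
    refine ((((hasDerivAt_pow (k + 1) x).const_mul (((k : ℝ) + 3) * (k + 2))).const_add
      (-((k : ℝ) + 3))).sub
      ((hasDerivAt_pow (k + 2) x).const_mul (((k : ℝ) + 1) * (k + 3)))).congr_deriv ?_
    push_cast [Nat.add_succ_sub_one]
    ring
  · rintro x ⟨h0, h1⟩
    have := sub_pos.2 h1
    positivity
  · ring
  · ring

lemma four_term_pos (k : ℕ) : ∀ x ∈ Ioo (0 : ℝ) 1,
    0 < (2 * ((k : ℝ) + 2) ^ 2 + 1) - 2 * (k + 3) ^ 2 * x + (k + 3) * (2 * k + 3) * x ^ (k + 2)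
      - k * (2 * k + 5) * x ^ (k + 3) := by
  refine pos_of_hasDerivAt_hasDerivAt_pos
    (f' := fun x => -(2 * ((k : ℝ) + 3) ^ 2) + (k + 3) * (2 * k + 3) * (k + 2) * x ^ (k + 1)
      - k * (2 * k + 5) * (k + 3) * x ^ (k + 2))
    (f'' := fun x => ((k : ℝ) + 3) * (k + 2) * x ^ k
      * (k * (2 * k + 5) * (1 - x) + 3)) ?_ ?_ ?_ ?_ ?_
  · intro x
    refine (((((hasDerivAt_id' x).const_mul (2 * ((k : ℝ) + 3) ^ 2)).const_sub
      (2 * ((k : ℝ) + 2) ^ 2 + 1)).add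
      ((hasDerivAt_pow (k + 2) x).const_mul (((k : ℝ) + 3) * (2 * k + 3)))).sub
      ((hasDerivAt_pow (k + 3) x).const_mul ((k : ℝ) * (2 * k + 5)))).congr_deriv ?_
    push_cast [Nat.add_succ_sub_one]
    ring
  · intro x
    refine ((((hasDerivAt_pow (k + 1) x).const_mul
      (((k : ℝ) + 3) * (2 * k + 3) * (k + 2))).const_add (-(2 * ((k : ℝ) + 3) ^ 2))).sub
      ((hasDerivAt_pow (k + 2) x).const_mul ((k : ℝ) * (2 * k + 5) * (k + 3)))).congr_deriv ?_
    push_cast [Nat.add_succ_sub_one]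
    ring
  · rintro x ⟨h0, h1⟩
    have := sub_pos.2 h1
    positivity
  · ring
  · ring

lemma six_term_pos (k : ℕ) : ∀ x ∈ Ioo (0 : ℝ) 1,
    0 < ((k : ℝ) + 1) * (k + 3) - (k + 3) * (k + 4) * x + (4 * (k + 2) ^ 2 + 2) * x ^ (k + 2)
      - 4 * (k + 1) * (k + 3) * x ^ (k + 3) + (k + 1) * (k + 3) * x ^ (2 * k + 4)
      - (k + 1) * k * x ^ (2 * k + 5) := by
  refine pos_of_hasDerivAt_hasDerivAt_pos
    (f' := fun x => -(((k : ℝ) + 3) * (k + 4)) + (4 * (k + 2) ^ 2 + 2) * (k + 2) * x ^ (k + 1)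
      - 4 * (k + 1) * (k + 3) * (k + 3) * x ^ (k + 2)
      + (k + 1) * (k + 3) * (2 * k + 4) * x ^ (2 * k + 3)
      - (k + 1) * k * (2 * k + 5) * x ^ (2 * k + 4))
    (f'' := fun x => 2 * ((k : ℝ) + 2) * (k + 1) * x ^ k
      * ((2 * ((k : ℝ) + 2) ^ 2 + 1) - 2 * (k + 3) ^ 2 * x
        + (k + 3) * (2 * k + 3) * x ^ (k + 2) - k * (2 * k + 5) * x ^ (k + 3))) ?_ ?_ ?_ ?_ ?_
  · intro x
    refine (((((((hasDerivAt_id' x).const_mul (((k : ℝ) + 3) * (k + 4))).const_sub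
      (((k : ℝ) + 1) * (k + 3))).add
      ((hasDerivAt_pow (k + 2) x).const_mul (4 * ((k : ℝ) + 2) ^ 2 + 2))).sub
      ((hasDerivAt_pow (k + 3) x).const_mul (4 * ((k : ℝ) + 1) * (k + 3)))).add
      ((hasDerivAt_pow (2 * k + 4) x).const_mul (((k : ℝ) + 1) * (k + 3)))).sub
      ((hasDerivAt_pow (2 * k + 5) x).const_mul (((k : ℝ) + 1) * k))).congr_deriv ?_
    push_cast [Nat.add_succ_sub_one]
    ring
  · intro x
    refine ((((((hasDerivAt_pow (k + 1) x).const_mul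
      ((4 * ((k : ℝ) + 2) ^ 2 + 2) * (k + 2))).const_add (-(((k : ℝ) + 3) * (k + 4)))).sub
      ((hasDerivAt_pow (k + 2) x).const_mul (4 * ((k : ℝ) + 1) * (k + 3) * (k + 3)))).add
      ((hasDerivAt_pow (2 * k + 3) x).const_mul (((k : ℝ) + 1) * (k + 3) * (2 * k + 4)))).sub
      ((hasDerivAt_pow (2 * k + 4) x).const_mul
        (((k : ℝ) + 1) * k * (2 * k + 5)))).congr_deriv ?_
    push_cast [Nat.add_succ_sub_one]
    ring
  · rintro x hx
    have h0 := hx.1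
    have := four_term_pos k x hx
    positivity
  · ring
  · ring

lemma geom_sum_eq_div {x : ℝ} (hx : x ≠ 1) (m : ℕ) :
    ∑ i ∈ Finset.range m, x ^ i = (1 - x ^ m) / (1 - x) := by
  rw [eq_div_iff (sub_ne_zero.2 hx.symm), mul_comm, mul_neg_geom_sum]

lemma hasDerivAt_one_sub_pow (k : ℕ) (x : ℝ) :
    HasDerivAt (fun y : ℝ => 1 - y ^ (k + 2)) (-((k + 2) * x ^ (k + 1))) x := by
  refine ((hasDerivAt_pow (k + 2) x).const_sub 1).congr_deriv ?_
  push_cast [Nat.add_succ_sub_one]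
  ring

lemma hasDerivAt_one_sub (x : ℝ) : HasDerivAt (fun y : ℝ => 1 - y) (-1) x :=
  (hasDerivAt_id' x).const_sub 1

lemma lt_two_mul_geom_sum_pow_three (k : ℕ) {x : ℝ} (hx : x ∈ Ioo (0 : ℝ) 1) :
    ((k : ℝ) + 2) ^ 2 * x ^ (k + 1) * ((k + 3) + (k + 1) * x ^ (k + 2))
      < 2 * (∑ i ∈ Finset.range (k + 2), x ^ i) ^ 3 := by
  have hA : ∀ y : ℝ, 0 < y → 0 < ∑ i ∈ Finset.range (k + 2), y ^ i := fun y hy =>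
    Finset.sum_pos (fun i _ => pow_pos hy i) ⟨0, by simp⟩
  have hK : ∀ y : ℝ, 0 < y → 0 < ((k : ℝ) + 3) + (k + 1) * y ^ (k + 2) := fun y hy => by
    positivity
  have key := pos_of_hasDerivAt_neg
    (f := fun y => 3 * Real.log (∑ i ∈ Finset.range (k + 2), y ^ i) - (k + 1) * Real.log y
      - Real.log (((k : ℝ) + 3) + (k + 1) * y ^ (k + 2)) - Real.log (((k : ℝ) + 2) ^ 2 / 2))
    (f' := fun y => -((((k : ℝ) + 1) * (k + 3) - (k + 3) * (k + 4) * y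
      + (4 * (k + 2) ^ 2 + 2) * y ^ (k + 2)
      - 4 * (k + 1) * (k + 3) * y ^ (k + 3) + (k + 1) * (k + 3) * y ^ (2 * k + 4)
      - (k + 1) * k * y ^ (2 * k + 5))
      / (y * (1 - y) * (1 - y ^ (k + 2)) * (((k : ℝ) + 3) + (k + 1) * y ^ (k + 2)))))
    ?_ ?_ ?_ ?_ x hx
  · have hx0 := hx.1
    have hlog : Real.log (((k : ℝ) + 2) ^ 2 / 2 * (x ^ (k + 1) *
        (((k : ℝ) + 3) + (k + 1) * x ^ (k + 2))))
        < Real.log ((∑ i ∈ Finset.range (k + 2), x ^ i) ^ 3) := by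
      rw [Real.log_mul (by positivity) (mul_pos (by positivity) (hK x hx0)).ne',
        Real.log_mul (by positivity) (hK x hx0).ne', Real.log_pow, Real.log_pow]
      push_cast
      linarith
    have := (Real.log_lt_log_iff (by positivity) (pow_pos (hA x hx0) 3)).1 hlog
    linarith
  · intro y hy
    have hy0 := hy.1
    have h1 := (hA y hy0).ne'
    have h2 := (hK y hy0).ne'
    have h3 := hy0.ne'
    apply ContinuousAt.continuousWithinAt
    fun_prop (disch := assumption)
  · intro y hy
    have hy0 := hy.1
    have hy1 : 0 < 1 - y := sub_pos.2 hy.2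
    have hu : 0 < 1 - y ^ (k + 2) := sub_pos.2 (pow_lt_one₀ hy0.le hy.2 (by simp))
    have hKy := hK y hy0
    have hd : HasDerivAt (fun y : ℝ => 3 * (Real.log (1 - y ^ (k + 2)) - Real.log (1 - y))
        - (k + 1) * Real.log y - Real.log (((k : ℝ) + 3) + (k + 1) * y ^ (k + 2))
        - Real.log (((k : ℝ) + 2) ^ 2 / 2)) _ y :=
      ((((((hasDerivAt_one_sub_pow k y).log hu.ne').sub
        ((hasDerivAt_one_sub y).log hy1.ne')).const_mul 3).sub
        ((Real.hasDerivAt_log hy0.ne').const_mul ((k : ℝ) + 1))).sub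
        ((((hasDerivAt_pow (k + 2) y).const_mul ((k : ℝ) + 1)).const_add
          ((k : ℝ) + 3)).log hKy.ne')).sub_const _
    refine (hd.congr_of_eventuallyEq ?_).congr_deriv ?_
    · filter_upwards [isOpen_Ioo.mem_nhds hy] with z hz
      rw [geom_sum_eq_div hz.2.ne, Real.log_div
        (sub_pos.2 (pow_lt_one₀ hz.1.le hz.2 (by simp))).ne' (sub_pos.2 hz.2).ne']
    · have e1 := hy0.ne'
      have e2 := hy1.ne'
      have e3 := hu.ne'
      have e4 := hKy.ne'
      push_cast [Nat.add_succ_sub_one]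
      have p1 : y ^ (k + 2) = y ^ (k + 1) * y := by ring
      have p2 : y ^ (k + 3) = y ^ 2 * y ^ (k + 1) := by ring
      have p3 : y ^ (2 * k + 4) = y ^ 2 * (y ^ (k + 1)) ^ 2 := by ring
      have p4 : y ^ (2 * k + 5) = y ^ 3 * (y ^ (k + 1)) ^ 2 := by ring
      rw [p1] at e3 e4
      rw [mul_comm ((k : ℝ) + 1)] at e4
      rw [p1, p2, p3, p4]
      generalize y ^ (k + 1) = w at *
      field_simp
      ring
  · intro y hy
    have hy0 := hy.1
    have hy1 : 0 < 1 - y := sub_pos.2 hy.2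
    have hu : 0 < 1 - y ^ (k + 2) := sub_pos.2 (pow_lt_one₀ hy0.le hy.2 (by simp))
    have hKy := hK y hy0
    have := six_term_pos k y hy
    exact neg_neg_of_pos (by positivity)
  · have h : ((k : ℝ) + 3) + (k + 1) = 2 * (k + 2) := by ring
    have hk : ((k : ℝ) + 2) ≠ 0 := by positivity
    simp only [one_pow, Finset.sum_const, Finset.card_range, nsmul_eq_mul, mul_one, Real.log_one,
      mul_zero, sub_zero, h]
    push_cast
    rw [Real.log_mul two_ne_zero hk, Real.log_div (by positivity) two_ne_zero, Real.log_pow]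
    push_cast
    ring

lemma socialRate_eq_geom_sum (R C μ : ℝ) (k : ℕ) {x : ℝ} (hx : x ∈ Icc (0 : ℝ) 1) :
    socialRate R C μ (k + 1) x =
      (R * μ - C * (k + 2)) * (1 - 1 / ∑ i ∈ Finset.range (k + 2), x ^ i)
      + C * (x * (∑ i ∈ Finset.range (k + 2), ∑ j ∈ Finset.range i, x ^ j)
        / ∑ i ∈ Finset.range (k + 2), x ^ i) := by
  have hk : ((k : ℝ) + 2) ≠ 0 := by positivity
  unfold socialRate
  split_ifs with h
  · subst h
    have hs : (∑ i ∈ Finset.range (k + 2), (i : ℝ)) * 2 = (k + 2) * (k + 1) := by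
      have : (∑ i ∈ Finset.range (k + 2), i) * 2 = (k + 2) * (k + 1) :=
        Finset.sum_range_id_mul_two (k + 2)
      have := congrArg (Nat.cast (R := ℝ)) this
      push_cast at this
      exact this
    have hs' : (∑ i ∈ Finset.range (k + 2), (i : ℝ)) = (k + 2) * (k + 1) / 2 := by linarith
    simp only [one_pow, Finset.sum_const, Finset.card_range, nsmul_eq_mul, mul_one, hs']
    push_cast
    have hk' : ((k : ℝ) + 1 + 1) ≠ 0 := by positivity
    field_simp
    ring
  · have hx1 : 1 - x ≠ 0 := sub_ne_zero.2 (Ne.symm h)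
    have hu : 1 - x ^ (k + 2) ≠ 0 :=
      (sub_pos.2 (pow_lt_one₀ hx.1 (lt_of_le_of_ne hx.2 h) (by simp))).ne'
    have hB : (∑ i ∈ Finset.range (k + 2), ∑ j ∈ Finset.range i, x ^ j)
        = ((k + 2) - (1 - x ^ (k + 2)) / (1 - x)) / (1 - x) := by
      simp_rw [geom_sum_eq_div h, ← Finset.sum_div, Finset.sum_sub_distrib, geom_sum_eq_div h]
      simp
    rw [hB, geom_sum_eq_div h]
    push_cast
    have p1 : x ^ (k + 2) = x * x ^ (k + 1) := by ring
    rw [p1] at hu ⊢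
    generalize x ^ (k + 1) = w at *
    field_simp
    ring

lemma socialRate_eq_of_mem_Ioo (R C μ : ℝ) (k : ℕ) {x : ℝ} (hx : x ∈ Ioo (0 : ℝ) 1) :
    socialRate R C μ (k + 1) x =
      (R * μ - C * (k + 2)) * (1 - (1 - x) / (1 - x ^ (k + 2)))
      + C * ((k + 2) * (x / (1 - x ^ (k + 2))) - x / (1 - x)) := by
  have hx1 : 1 - x ≠ 0 := (sub_pos.2 hx.2).ne'
  have hu : 1 - x ^ (k + 2) ≠ 0 := (sub_pos.2 (pow_lt_one₀ hx.1.le hx.2 (by simp))).ne'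
  rw [socialRate, if_neg hx.2.ne]
  push_cast
  have p1 : x ^ (k + 2) = x * x ^ (k + 1) := by ring
  rw [p1] at hu ⊢
  generalize x ^ (k + 1) = w at *
  field_simp
  ring

theorem stmt2 (R C μ : ℝ) (hR : 0 < R) (hC : 0 < C) (hμ : 0 < μ)
    (n : ℕ) (hn : 1 ≤ n) (hRC : (n : ℝ) + 1 ≤ R * μ / C) :
    StrictConcaveOn ℝ (Set.Icc (0 : ℝ) 1) (socialRate R C μ n) := by
  obtain ⟨k, rfl⟩ : ∃ k, n = k + 1 := ⟨n - 1, by omega⟩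
  have hα : 0 ≤ R * μ - C * (k + 2) := by
    rw [le_div_iff₀ hC] at hRC
    push_cast at hRC
    linarith
  set α := R * μ - C * (k + 2) with hα_def
  have hu : ∀ x ∈ Ioo (0 : ℝ) 1, 0 < 1 - x ^ (k + 2) := fun x hx =>
    sub_pos.2 (pow_lt_one₀ hx.1.le hx.2 (by simp))
  have hcont : ContinuousOn (socialRate R C μ (k + 1)) (Icc 0 1) := by
    refine ContinuousOn.congr ?_ fun x hx => socialRate_eq_geom_sum R C μ k hx
    intro x hx
    have hA : (∑ i ∈ Finset.range (k + 2), x ^ i) ≠ 0 := (geom_sum_pos hx.1 (by simp)).ne'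
    apply ContinuousAt.continuousWithinAt
    fun_prop (disch := assumption)
  have hderiv : ∀ x ∈ Ioo (0 : ℝ) 1, HasDerivAt (socialRate R C μ (k + 1))
      (α * ((1 - x ^ (k + 2) - (1 - x) * ((k + 2) * x ^ (k + 1))) / (1 - x ^ (k + 2)) ^ 2)
        + C * ((k + 2) * ((1 + (k + 1) * x ^ (k + 2)) / (1 - x ^ (k + 2)) ^ 2)
          - 1 / (1 - x) ^ 2)) x := by
    intro x hx
    have hx1 : 1 - x ≠ 0 := (sub_pos.2 hx.2).ne'
    have hux := (hu x hx).ne'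
    have hd := ((((hasDerivAt_one_sub x).div (hasDerivAt_one_sub_pow k x) hux).const_sub
      1).const_mul α).add (((((hasDerivAt_id' x).div (hasDerivAt_one_sub_pow k x)
        hux).const_mul ((k : ℝ) + 2)).sub
        ((hasDerivAt_id' x).div (hasDerivAt_one_sub x) hx1)).const_mul C)
    refine (hd.congr_of_eventuallyEq ?_).congr_deriv ?_
    · filter_upwards [isOpen_Ioo.mem_nhds hx] with z hz
      exact socialRate_eq_of_mem_Ioo R C μ k hz
    · have p1 : x ^ (k + 2) = x * x ^ (k + 1) := by ring
      rw [p1] at hux ⊢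
      generalize x ^ (k + 1) = w at *
      field_simp
      ring
  have hanti : StrictAntiOn (fun x : ℝ =>
      α * ((1 - x ^ (k + 2) - (1 - x) * ((k + 2) * x ^ (k + 1))) / (1 - x ^ (k + 2)) ^ 2)
        + C * ((k + 2) * ((1 + (k + 1) * x ^ (k + 2)) / (1 - x ^ (k + 2)) ^ 2)
          - 1 / (1 - x) ^ 2)) (Ioo 0 1) := by
    have hd : ∀ x ∈ Ioo (0 : ℝ) 1, HasDerivAt (fun x : ℝ =>
      α * ((1 - x ^ (k + 2) - (1 - x) * ((k + 2) * x ^ (k + 1))) / (1 - x ^ (k + 2)) ^ 2)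
        + C * ((k + 2) * ((1 + (k + 1) * x ^ (k + 2)) / (1 - x ^ (k + 2)) ^ 2)
          - 1 / (1 - x) ^ 2))
      (-(α * ((k + 2) * x ^ k * (((k : ℝ) + 1) - (k + 3) * x + (k + 3) * x ^ (k + 2)
          - (k + 1) * x ^ (k + 3)) / (1 - x ^ (k + 2)) ^ 3))
        - C * (2 / (1 - x) ^ 3 - ((k : ℝ) + 2) ^ 2 * x ^ (k + 1)
          * ((k + 3) + (k + 1) * x ^ (k + 2)) / (1 - x ^ (k + 2)) ^ 3)) x := by
      intro x hx
      have hx1 : 1 - x ≠ 0 := (sub_pos.2 hx.2).ne'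
      have hux := (hu x hx).ne'
      have hu2 := (hasDerivAt_one_sub_pow k x).pow 2
      have hd := (((((hasDerivAt_one_sub_pow k x).sub ((hasDerivAt_one_sub x).mul
        ((hasDerivAt_pow (k + 1) x).const_mul ((k : ℝ) + 2)))).div hu2
          (pow_ne_zero 2 hux)).const_mul α)).add
        ((((((((hasDerivAt_pow (k + 2) x).const_mul ((k : ℝ) + 1)).const_add 1).div hu2
          (pow_ne_zero 2 hux)).const_mul ((k : ℝ) + 2))).sub
          ((hasDerivAt_const x (1 : ℝ)).div ((hasDerivAt_one_sub x).pow 2)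
            (pow_ne_zero 2 hx1))).const_mul C)
      refine hd.congr_deriv ?_
      push_cast [Nat.add_succ_sub_one, Pi.pow_apply, Pi.mul_apply, Pi.sub_apply]
      have p0 : x ^ (k + 1) = x * x ^ k := by ring
      have p1 : x ^ (k + 2) = x ^ 2 * x ^ k := by ring
      have p2 : x ^ (k + 3) = x ^ 3 * x ^ k := by ring
      rw [p1] at hux
      simp only [p0, p1, p2]
      generalize x ^ k = w at *
      field_simp
      ring
    refine strictAntiOn_of_deriv_neg (convex_Ioo 0 1)
      (fun x hx => (hd x hx).continuousAt.continuousWithinAt) fun x hx => ?_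
    rw [interior_Ioo] at hx
    rw [(hd x hx).deriv]
    have hx0 := hx.1
    have hx1 : 0 < 1 - x := sub_pos.2 hx.2
    have hux := hu x hx
    have hq := inv_geom_numerator_pos k x hx
    have hA := lt_two_mul_geom_sum_pow_three k hx
    rw [geom_sum_eq_div hx.2.ne, div_pow, ← mul_div_assoc, lt_div_iff₀ (by positivity)] at hA
    have hlt : ((k : ℝ) + 2) ^ 2 * x ^ (k + 1) * ((k + 3) + (k + 1) * x ^ (k + 2))
        / (1 - x ^ (k + 2)) ^ 3 < 2 / (1 - x) ^ 3 :=
      (div_lt_div_iff₀ (by positivity) (by positivity)).2 hA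
    have h1 := mul_pos hC (sub_pos.2 hlt)
    have h2 : 0 ≤ α * ((k + 2) * x ^ k * (((k : ℝ) + 1) - (k + 3) * x + (k + 3) * x ^ (k + 2)
          - (k + 1) * x ^ (k + 3)) / (1 - x ^ (k + 2)) ^ 3) := by positivity
    linarith
  refine StrictAntiOn.strictConcaveOn_of_deriv (convex_Icc 0 1) hcont ?_
  rw [interior_Icc]
  exact hanti.congr fun x hx => (hderiv x hx).deriv.symm
end

section
/- Let R, C, μ > 0 and let n ≥ 1 be an integer with Rμ/C ≥ n + 1. Then the sign of the second derivative f_n'' changes at most once on (0, ∞): there exists ρ₀ ∈ (0, ∞] such that f_n''(ρ) ≤ 0 for all ρ ∈ (0, ρ₀) and f_n''(ρ) ≥ 0 for all ρ ∈ (ρ₀, ∞). -/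
open scoped ENNReal

section Alternation

variable {u v : ℕ → ℝ}

/-- A sequence taking a negative value has a negative increment at or before that place. -/
lemma exists_increment_neg (h0 : v 0 = u 0) (hs : ∀ k, v (k + 1) = u (k + 1) - u k)
    {i : ℕ} (hi : u i < 0) : ∃ k ≤ i, v k < 0 := by
  by_contra! h
  have : ∀ j ≤ i, 0 ≤ u j := by
    intro j
    induction j with
    | zero => intro hj; rw [← h0]; exact h 0 hj
    | succ j ih =>
      intro hj
      have h1 := ih (by omega)
      have h2 := h (j + 1) hj
      rw [hs] at h2
      linarith
  exact absurd (this i le_rfl) (not_le.2 hi)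

lemma exists_increment_pos_of_lt (hs : ∀ k, v (k + 1) = u (k + 1) - u k)
    {i j : ℕ} (hij : i ≤ j) (hu : u i < u j) : ∃ k, i < k ∧ k ≤ j ∧ 0 < v k := by
  by_contra! h
  have : ∀ l, i ≤ l → l ≤ j → u l ≤ u i := by
    intro l hl
    induction l, hl using Nat.le_induction with
    | base => intro _; exact le_rfl
    | succ l hl ih =>
      intro hj
      have h1 := ih (by omega)
      have h2 := h (l + 1) (by omega) hj
      rw [hs] at h2
      linarith
  exact absurd (this j hij le_rfl) (not_le.2 hu)

lemma exists_increment_neg_of_lt (hs : ∀ k, v (k + 1) = u (k + 1) - u k)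
    {i j : ℕ} (hij : i ≤ j) (hu : u j < u i) : ∃ k, i < k ∧ k ≤ j ∧ v k < 0 := by
  obtain ⟨k, h1, h2, h3⟩ := exists_increment_pos_of_lt (u := fun k => -u k)
    (v := fun k => -v k) (fun k => by rw [hs]; ring) hij (neg_lt_neg hu)
  exact ⟨k, h1, h2, neg_pos.1 h3⟩

end Alternation

namespace Polynomial

lemma coeff_one_sub_X_mul_zero (P : ℝ[X]) : ((1 - X) * P).coeff 0 = P.coeff 0 := by
  simp [sub_mul]

lemma coeff_one_sub_X_mul_succ (P : ℝ[X]) (k : ℕ) :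
    ((1 - X) * P).coeff (k + 1) = P.coeff (k + 1) - P.coeff k := by
  simp [sub_mul]

/-- If `(1 - X) ^ 3 * P` has at most two negative coefficients, then no coefficient of `P` after a
negative one is positive. -/
lemma coeff_nonpos_of_one_sub_X_pow_three_mul {P : ℝ[X]} {a b : ℕ}
    (hQ : ∀ i, i ≠ a → i ≠ b → 0 ≤ ((1 - X) ^ 3 * P).coeff i)
    {i j : ℕ} (hij : i < j) (hi : P.coeff i < 0) : P.coeff j ≤ 0 := by
  by_contra! hj
  have hfin : ∀ (R : ℝ[X]) (k : ℕ), ∃ N, k < N ∧ R.coeff N = 0 := fun R k =>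
    ⟨R.natDegree + k + 1, by omega, coeff_eq_zero_of_natDegree_lt (by omega)⟩
  have e : (1 - X) ^ 3 * P = (1 - X) * ((1 - X) * ((1 - X) * P)) := by ring
  rw [e] at hQ
  obtain ⟨N, hjN, hN⟩ := hfin P j
  have z := coeff_one_sub_X_mul_zero P
  have s := coeff_one_sub_X_mul_succ P
  obtain ⟨k₁, _, n₁⟩ := exists_increment_neg z s hi
  obtain ⟨k₂, _, _, p₂⟩ := exists_increment_pos_of_lt s hij.le (hi.trans hj)
  obtain ⟨k₃, _, _, n₃⟩ := exists_increment_neg_of_lt s hjN.le (hN.trans_lt hj)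
  generalize (1 - X) * P = P' at *
  obtain ⟨M, hM', hM⟩ := hfin P' k₃
  have z := coeff_one_sub_X_mul_zero P'
  have s := coeff_one_sub_X_mul_succ P'
  obtain ⟨l₁, _, n₁'⟩ := exists_increment_neg z s n₁
  obtain ⟨l₂, _, _, p₂'⟩ := exists_increment_pos_of_lt s (by omega) (n₁.trans p₂)
  obtain ⟨l₃, _, _, n₃'⟩ := exists_increment_neg_of_lt s (by omega) (n₃.trans p₂)
  obtain ⟨l₄, _, _, p₄'⟩ := exists_increment_pos_of_lt s hM'.le (n₃.trans_eq hM.symm)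
  generalize (1 - X) * P' = P'' at *
  obtain ⟨L, hL', hL⟩ := hfin P'' l₄
  have z := coeff_one_sub_X_mul_zero P''
  have s := coeff_one_sub_X_mul_succ P''
  obtain ⟨c₁, _, d₁⟩ := exists_increment_neg z s n₁'
  obtain ⟨c₂, _, _, d₂⟩ := exists_increment_neg_of_lt s (i := l₂) (j := l₃) (by omega)
    (n₃'.trans p₂')
  obtain ⟨c₃, _, _, d₃⟩ := exists_increment_neg_of_lt s hL'.le (hL.trans_lt p₄')
  have key : ∀ c, ((1 - X) * P'').coeff c < 0 → c = a ∨ c = b := by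
    intro c hc
    by_contra! h
    exact absurd (hQ c h.1 h.2) (not_le.2 hc)
  have := key _ d₁
  have := key _ d₂
  have := key _ d₃
  omega

/-- If no coefficient after a negative one is positive, the polynomial changes sign on `(0, ∞)` at
most once, from positive to negative. -/
lemma eval_nonpos_of_coeff {P : ℝ[X]}
    (hP : ∀ i j, i < j → P.coeff i < 0 → P.coeff j ≤ 0)
    {a b : ℝ} (ha : 0 < a) (hab : a < b) (h : P.eval a < 0) : P.eval b ≤ 0 := by
  have hb := ha.trans hab
  have hex : ∃ k, P.coeff k < 0 := by
    by_contra! hc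
    rw [eval_eq_sum_range] at h
    exact absurd (Finset.sum_nonneg fun i _ => mul_nonneg (hc i) (by positivity)) (not_le.2 h)
  classical
  obtain ⟨K, hK, hmin⟩ : ∃ K, P.coeff K < 0 ∧ ∀ k < K, 0 ≤ P.coeff k :=
    ⟨Nat.find hex, Nat.find_spec hex, fun k hk => not_lt.1 (Nat.find_min hex hk)⟩
  have key : P.eval b * a ^ K ≤ P.eval a * b ^ K := by
    simp only [eval_eq_sum_range, Finset.sum_mul]
    refine Finset.sum_le_sum fun k _ => ?_
    rw [mul_assoc, mul_assoc]
    rcases lt_or_ge k K with hk | hk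
    · refine mul_le_mul_of_nonneg_left ?_ (hmin k hk)
      obtain ⟨d, rfl⟩ := Nat.exists_eq_add_of_lt hk
      have : a ^ (d + 1) ≤ b ^ (d + 1) := by gcongr
      calc b ^ k * a ^ (k + d + 1) = a ^ k * b ^ k * a ^ (d + 1) := by ring
        _ ≤ a ^ k * b ^ k * b ^ (d + 1) := by gcongr
        _ = _ := by ring
    · have hc : P.coeff k ≤ 0 := by
        rcases hk.eq_or_lt with rfl | hk
        · exact hK.le
        · exact hP K k hk hK
      refine mul_le_mul_of_nonpos_left ?_ hc
      obtain ⟨d, rfl⟩ := Nat.exists_eq_add_of_le hk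
      have : a ^ d ≤ b ^ d := by gcongr
      calc a ^ (K + d) * b ^ K = a ^ K * b ^ K * a ^ d := by ring
        _ ≤ a ^ K * b ^ K * b ^ d := by gcongr
        _ = _ := by ring
  by_contra! hpos
  have h1 : 0 < P.eval b * a ^ K := by positivity
  have h2 : P.eval a * b ^ K < 0 := mul_neg_of_neg_of_pos h (by positivity)
  linarith

/-- The polynomial `1 + X + ⋯ + X ^ (k + 1)`. -/
noncomputable def geomPoly (k : ℕ) : ℝ[X] := ∑ i ∈ Finset.range (k + 2), X ^ i

lemma coeff_geomPoly (k i : ℕ) : (geomPoly k).coeff i = if i < k + 2 then 1 else 0 := by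
  simp [geomPoly, coeff_X_pow]

lemma eval_geomPoly_pos (k : ℕ) {x : ℝ} (hx : 0 < x) : 0 < (geomPoly k).eval x := by
  simp only [geomPoly, eval_finsetSum, eval_pow, eval_X]
  exact Finset.sum_pos (fun i _ => by positivity) ⟨0, by simp⟩

lemma one_sub_X_mul_geomPoly (k : ℕ) : (1 - X) * geomPoly k = 1 - X ^ 2 * X ^ k := by
  rw [geomPoly, mul_neg_geom_sum]
  ring

lemma one_sub_X_mul_derivative_geomPoly (k : ℕ) :
    (1 - X) * derivative (geomPoly k) = geomPoly k - C ((k : ℝ) + 2) * X * X ^ k := by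
  have h := congrArg derivative (mul_neg_geom_sum (X : ℝ[X]) (k + 2))
  rw [← geomPoly] at h
  simp only [derivative_mul, derivative_sub, derivative_one, derivative_X, derivative_X_pow] at h
  simp at h ⊢
  linear_combination h

lemma one_sub_X_mul_derivative2_geomPoly (k : ℕ) :
    (1 - X) * derivative (derivative (geomPoly k)) =
      2 * derivative (geomPoly k) - C (((k : ℝ) + 2) * (k + 1)) * X ^ k := by
  have h := congrArg derivative (one_sub_X_mul_derivative_geomPoly k)
  rw [mul_assoc, ← pow_succ'] at h
  simp only [derivative_mul, derivative_sub, derivative_one, derivative_X, derivative_X_pow,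
    derivative_C] at h
  simp at h ⊢
  linear_combination h

lemma one_sub_X_mul_X_mul_derivative3_geomPoly (k : ℕ) :
    (1 - X) * (X * derivative (derivative (derivative (geomPoly k)))) =
      3 * X * derivative (derivative (geomPoly k)) -
        C (((k : ℝ) + 2) * (k + 1) * k) * X ^ k := by
  have h := congrArg derivative (one_sub_X_mul_derivative2_geomPoly k)
  have hk : C (k : ℝ) * X ^ (k - 1) * X = C (k : ℝ) * X ^ k := by
    rcases k with _ | k
    · simp
    · simp [pow_succ, mul_assoc]
  simp only [derivative_mul, derivative_sub, derivative_one, derivative_X, derivative_X_pow,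
    derivative_C, derivative_ofNat] at h
  have h2 : (C 2 : ℝ[X]) = 2 := rfl
  simp [h2] at h hk ⊢
  linear_combination X * h - ((k : ℝ[X]) + 2) * (k + 1) * hk

/-- With `S = geomPoly k`, the numerator over `S ^ 3` of the second derivative of
`V * (1 - 1 / S) - X * S' / S`. -/
noncomputable def rateNumerator (V : ℝ) (k : ℕ) : ℝ[X] :=
  let S := geomPoly k
  let S₁ := derivative S
  let S₂ := derivative S₁
  let S₃ := derivative S₂
  C V * (S * S₂ - 2 * S₁ ^ 2) - (2 * S₂ + X * S₃) * S ^ 2 + 2 * (S₁ + X * S₂) * S₁ * S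
    + X * S₁ * S₂ * S - 2 * X * S₁ ^ 3

lemma one_sub_X_pow_three_mul_rateNumerator (V : ℝ) (k : ℕ) :
    (1 - X) ^ 3 * -(X * rateNumerator V k) =
      2 * (X * geomPoly k ^ 3)
      + C ((V - (k + 2)) * (k + 2) * (k + 1)) * X ^ (k + 1)
      + C ((V - (k + 2)) * (k + 2) * (k + 3)) * X ^ (2 * k + 3)
      - C ((k + 2) * (k + 3) * V) * X ^ (k + 2)
      - C ((k + 2) * (k + 1) * V) * X ^ (2 * k + 4) := by
  have r0 := one_sub_X_mul_geomPoly k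
  have r1 := one_sub_X_mul_derivative_geomPoly k
  have r2 := one_sub_X_mul_derivative2_geomPoly k
  have r3 := one_sub_X_mul_X_mul_derivative3_geomPoly k
  have hne : ((1 - X : ℝ[X])) ^ 3 ≠ 0 := by
    refine pow_ne_zero _ fun h => ?_
    have := congrArg (eval 0) h
    simp at this
  refine mul_left_cancel₀ hne ?_
  simp only [rateNumerator]
  have p1 : X ^ (k + 1) = (X : ℝ[X]) * X ^ k := by ring
  have p2 : X ^ (k + 2) = (X : ℝ[X]) ^ 2 * X ^ k := by ring
  have p3 : X ^ (2 * k + 3) = (X : ℝ[X]) ^ 3 * (X ^ k) ^ 2 := by ring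
  have p4 : X ^ (2 * k + 4) = (X : ℝ[X]) ^ 4 * (X ^ k) ^ 2 := by ring
  rw [p1, p2, p3, p4]
  simp only [map_mul, map_add, map_sub, map_one, map_natCast, map_ofNat] at r1 r2 r3 ⊢
  generalize derivative (derivative (derivative (geomPoly k))) = S₃ at *
  generalize derivative (derivative (geomPoly k)) = S₂ at *
  generalize derivative (geomPoly k) = S₁ at *
  generalize geomPoly k = S at *
  generalize (X : ℝ[X]) ^ k = y at *
  generalize (k : ℝ[X]) = c at *
  generalize (C V : ℝ[X]) = v at *
  generalize (X : ℝ[X]) = x at *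
  obtain ⟨e, he⟩ : ∃ e, 1 - x = e := ⟨_, rfl⟩
  rw [he] at r0 r1 r2 r3 ⊢
  have w1 : e ^ 2 * S₁ = (1 - x ^ 2 * y) - (c + 2) * e * x * y := by
    linear_combination e * r1 + r0
  have w2 : e ^ 3 * S₂ = 2 * ((1 - x ^ 2 * y) - (c + 2) * e * x * y)
      - (c + 2) * (c + 1) * e ^ 2 * y := by
    linear_combination e ^ 2 * r2 + 2 * w1
  have w3 : e ^ 4 * (x * S₃) = 3 * x * (2 * ((1 - x ^ 2 * y) - (c + 2) * e * x * y)
      - (c + 2) * (c + 1) * e ^ 2 * y) - (c + 2) * (c + 1) * c * e ^ 3 * y := by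
    linear_combination e ^ 3 * r3 + 3 * x * w2
  have l : e ^ 3 * (e ^ 3 * -(x * (v * (S * S₂ - 2 * S₁ ^ 2) - (2 * S₂ + x * S₃) * S ^ 2 +
      2 * (S₁ + x * S₂) * S₁ * S + x * S₁ * S₂ * S - 2 * x * S₁ ^ 3))) =
      -x * (v * (e ^ 2 * ((e * S) * (e ^ 3 * S₂)) - 2 * e ^ 2 * (e ^ 2 * S₁) ^ 2)
        - (2 * e * (e ^ 3 * S₂) + (e ^ 4 * (x * S₃))) * (e * S) ^ 2
        + 2 * (e * (e ^ 2 * S₁) + x * (e ^ 3 * S₂)) * (e ^ 2 * S₁) * (e * S)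
        + x * (e ^ 2 * S₁) * (e ^ 3 * S₂) * (e * S) - 2 * x * (e ^ 2 * S₁) ^ 3) := by
    ring
  have r : e ^ 3 * (2 * (x * S ^ 3)) = 2 * x * (e * S) ^ 3 := by ring
  rw [l, mul_sub (e ^ 3), mul_sub (e ^ 3), mul_add (e ^ 3), mul_add (e ^ 3), r, w1, w2, w3, r0, ← he]
  ring

lemma coeff_geomPoly_pow_nonneg (k j i : ℕ) : 0 ≤ (geomPoly k ^ j).coeff i := by
  induction j generalizing i with
  | zero => rw [pow_zero, coeff_one]; split_ifs <;> norm_num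
  | succ j ih =>
    rw [pow_succ, coeff_mul]
    refine Finset.sum_nonneg fun p _ => mul_nonneg (ih _) ?_
    rw [coeff_geomPoly]
    split_ifs <;> norm_num

lemma rateNumerator_eval_nonneg {V : ℝ} {k : ℕ} (hV : (k : ℝ) + 2 ≤ V) {a b : ℝ} (ha : 0 < a)
    (hab : a < b) (h : 0 < (rateNumerator V k).eval a) : 0 ≤ (rateNumerator V k).eval b := by
  have hQ : ∀ i, i ≠ k + 2 → i ≠ 2 * k + 4 →
      0 ≤ ((1 - X) ^ 3 * -(X * rateNumerator V k)).coeff i := by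
    intro i h1 h2
    have hd : 0 ≤ V - (k + 2) := by linarith
    have hS : 0 ≤ (X * geomPoly k ^ 3).coeff i := by
      rcases i with _ | i
      · simp
      · rw [coeff_X_mul]; exact coeff_geomPoly_pow_nonneg k 3 i
    rw [one_sub_X_pow_three_mul_rateNumerator]
    have h2' : (2 * (X * geomPoly k ^ 3)).coeff i = 2 * (X * geomPoly k ^ 3).coeff i := by
      rw [← C_ofNat, coeff_C_mul]
    simp only [coeff_add, coeff_sub, coeff_C_mul_X_pow, h2', if_neg h1, if_neg h2, sub_zero]
    split_ifs <;> positivity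
  have := eval_nonpos_of_coeff
    (fun i j hij hi => coeff_nonpos_of_one_sub_X_pow_three_mul hQ hij hi) ha hab
    (by simpa using mul_pos ha h)
  simp only [eval_neg, eval_mul, eval_X, neg_nonpos] at this
  exact nonneg_of_mul_nonneg_right this (ha.trans hab)

lemma rateNumerator_eval_zero_neg {V : ℝ} {k : ℕ} (hV : (k : ℝ) + 2 ≤ V) :
    (rateNumerator V k).eval 0 < 0 := by
  have h0 : (geomPoly k).eval 0 = 1 := by
    rw [← coeff_zero_eq_eval_zero, coeff_geomPoly]; simp
  have h1 : (derivative (geomPoly k)).eval 0 = 1 := by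
    rw [← coeff_zero_eq_eval_zero, coeff_derivative, coeff_geomPoly]; simp
  have h2 : (derivative (derivative (geomPoly k))).eval 0 = if k = 0 then 0 else 2 := by
    rw [← coeff_zero_eq_eval_zero, coeff_derivative, coeff_derivative, coeff_geomPoly]
    rcases k with _ | k
    · simp
    · simp; norm_num
  simp only [rateNumerator, eval_sub, eval_add, eval_mul, eval_pow, eval_C, eval_X, eval_ofNat,
    h0, h1, h2]
  have : (0 : ℝ) ≤ k := k.cast_nonneg
  split_ifs <;> linarith

lemma hasDerivAt_rate (V : ℝ) (k : ℕ) {x : ℝ} (hx : 0 < x) :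
    HasDerivAt (fun x => V * (1 - 1 / (geomPoly k).eval x)
        - x * (derivative (geomPoly k)).eval x / (geomPoly k).eval x)
      ((V * (derivative (geomPoly k)).eval x
        - ((derivative (geomPoly k)).eval x + x * (derivative (derivative (geomPoly k))).eval x)
          * (geomPoly k).eval x
        + x * (derivative (geomPoly k)).eval x ^ 2) / (geomPoly k).eval x ^ 2) x := by
  have hS := (eval_geomPoly_pos k hx).ne'
  have d0 := (geomPoly k).hasDerivAt x
  have d1 := (derivative (geomPoly k)).hasDerivAt x
  have := (((hasDerivAt_const x (1 : ℝ)).sub ((hasDerivAt_const x (1 : ℝ)).div d0 hS)).const_mul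
    V).sub (((hasDerivAt_id' x).mul d1).div d0 hS)
  refine this.congr_deriv ?_
  simp only [Pi.mul_apply]
  field_simp
  ring

lemma hasDerivAt_deriv_rate (V : ℝ) (k : ℕ) {x : ℝ} (hx : 0 < x) :
    HasDerivAt (fun x => (V * (derivative (geomPoly k)).eval x
        - ((derivative (geomPoly k)).eval x + x * (derivative (derivative (geomPoly k))).eval x)
          * (geomPoly k).eval x
        + x * (derivative (geomPoly k)).eval x ^ 2) / (geomPoly k).eval x ^ 2)
      ((rateNumerator V k).eval x / (geomPoly k).eval x ^ 3) x := by
  have hS := (eval_geomPoly_pos k hx).ne'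
  have d0 := (geomPoly k).hasDerivAt x
  have d1 := (derivative (geomPoly k)).hasDerivAt x
  have d2 := (derivative (derivative (geomPoly k))).hasDerivAt x
  have hi := hasDerivAt_id' x
  have := (((d1.const_mul V).sub ((d1.add (hi.mul d2)).mul d0)).add (hi.mul (d1.pow 2))).div
    (d0.pow 2) (pow_ne_zero 2 hS)
  refine this.congr_deriv ?_
  simp only [rateNumerator, eval_sub, eval_add, eval_mul, eval_pow, eval_C, eval_X, eval_ofNat,
    Pi.mul_apply, Pi.pow_apply, Pi.add_apply, Pi.sub_apply]
  field_simp
  push_cast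
  ring

end Polynomial

open Polynomial in
lemma socialRate_eq_geomPoly (R c μ : ℝ) (hc : c ≠ 0) (k : ℕ) {x : ℝ} (hx : 0 < x) :
    socialRate R c μ (k + 1) x = c * (R * μ / c * (1 - 1 / (geomPoly k).eval x)
        - x * (derivative (geomPoly k)).eval x / (geomPoly k).eval x) := by
  have hS := (eval_geomPoly_pos k hx).ne'
  have r0 := congrArg (eval x) (one_sub_X_mul_geomPoly k)
  have r1 := congrArg (eval x) (one_sub_X_mul_derivative_geomPoly k)
  have r2 := congrArg (eval x) (one_sub_X_mul_derivative2_geomPoly k)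
  simp only [eval_sub, eval_mul, eval_pow, eval_C, eval_X, eval_one, eval_ofNat] at r0 r1 r2
  rw [socialRate]
  split_ifs with h1
  · subst h1
    simp only [one_pow, sub_self, zero_mul, mul_one] at r1 r2
    have e1 : (derivative (geomPoly k)).eval 1 = ((k : ℝ) + 2) * (k + 1) / 2 := by linarith
    have e0 : (geomPoly k).eval 1 = (k : ℝ) + 2 := by linarith
    rw [e0, e1]
    have : (k : ℝ) + 2 ≠ 0 := by positivity
    have h' : (k : ℝ) + 1 + 1 ≠ 0 := by positivity
    push_cast
    field_simp
    ring
  · have hx1 : 1 - x ≠ 0 := sub_ne_zero.2 (Ne.symm h1)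
    have e : 1 - x ^ (k + 1 + 1) = (1 - x) * (geomPoly k).eval x := by rw [r0]; ring
    have e1 : (derivative (geomPoly k)).eval x
        = ((geomPoly k).eval x - (k + 2) * x * x ^ k) / (1 - x) := by
      rw [← r1]; field_simp
    rw [e, e1]
    push_cast
    generalize (geomPoly k).eval x = s at *
    field_simp
    linear_combination -R * μ * r0

/-- The sign of the second derivative of `f_n` changes at most once on `(0, ∞)`:
there is a threshold `ρ₀ ∈ (0, ∞]` below which `f_n'' ≤ 0` and above which `f_n'' ≥ 0`. -/
theorem stmt4 (R C μ : ℝ) (hR : 0 < R) (hC : 0 < C) (hμ : 0 < μ)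
    (n : ℕ) (hn : 1 ≤ n) (hRC : (n : ℝ) + 1 ≤ R * μ / C) :
    ∃ ρ₀ : ℝ≥0∞, 0 < ρ₀ ∧
      (∀ ρ : ℝ, 0 < ρ → ENNReal.ofReal ρ < ρ₀ →
        deriv (deriv (socialRate R C μ n)) ρ ≤ 0) ∧
      (∀ ρ : ℝ, ρ₀ < ENNReal.ofReal ρ →
        0 ≤ deriv (deriv (socialRate R C μ n)) ρ) := by
  obtain ⟨k, rfl⟩ := Nat.exists_eq_add_of_le' hn
  have hV : (k : ℝ) + 2 ≤ R * μ / C := by push_cast at hRC; linarith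
  set V := R * μ / C with hVdef
  have hd1 : ∀ x : ℝ, 0 < x → HasDerivAt (socialRate R C μ (k + 1)) _ x := fun x hx =>
    ((Polynomial.hasDerivAt_rate V k hx).const_mul C).congr_of_eventuallyEq <| by
      filter_upwards [lt_mem_nhds hx] with y hy
      exact socialRate_eq_geomPoly R C μ hC.ne' k hy
  have hd2 : ∀ x : ℝ, 0 < x → deriv (deriv (socialRate R C μ (k + 1))) x =
      C * ((Polynomial.rateNumerator V k).eval x / (Polynomial.geomPoly k).eval x ^ 3) :=
    fun x hx => (((Polynomial.hasDerivAt_deriv_rate V k hx).const_mul C).congr_of_eventuallyEq <| by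
      filter_upwards [lt_mem_nhds hx] with y hy
      exact (hd1 y hy).deriv).deriv
  have hS : ∀ x : ℝ, 0 < x → 0 < (Polynomial.geomPoly k).eval x ^ 3 := fun x hx =>
    pow_pos (Polynomial.eval_geomPoly_pos k hx) 3
  let A : Set ℝ := {x | 0 < x ∧ 0 < (Polynomial.rateNumerator V k).eval x}
  refine ⟨⨅ x ∈ A, ENNReal.ofReal x, ?_, ?_, ?_⟩
  · have hev : ∀ᶠ x in nhds (0 : ℝ), (Polynomial.rateNumerator V k).eval x < 0 :=
      (Polynomial.rateNumerator V k).continuous.continuousAt.eventually_lt_const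
        (Polynomial.rateNumerator_eval_zero_neg hV)
    obtain ⟨ε, hε, hball⟩ := Metric.eventually_nhds_iff.1 hev
    refine (ENNReal.ofReal_pos.2 hε).trans_le (le_iInf₂ fun x hx => ?_)
    refine ENNReal.ofReal_le_ofReal (not_lt.1 fun hlt => ?_)
    refine absurd hx.2 (not_lt.2 (hball ?_).le)
    rw [Real.dist_eq, sub_zero, abs_of_pos hx.1]
    exact hlt
  · intro ρ hρ hlt
    rw [hd2 ρ hρ]
    refine mul_nonpos_of_nonneg_of_nonpos hC.le (div_nonpos_of_nonpos_of_nonneg ?_ (hS ρ hρ).le)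
    by_contra! hpos
    exact absurd (iInf₂_le ρ (show ρ ∈ A from ⟨hρ, hpos⟩)) (not_le.2 hlt)
  · intro ρ hlt
    obtain ⟨a, ha⟩ := iInf_lt_iff.1 hlt
    obtain ⟨haA, ha⟩ := iInf_lt_iff.1 ha
    have haρ : a < ρ := lt_of_not_ge fun h => absurd ha (not_lt.2 (ENNReal.ofReal_le_ofReal h))
    have hρ := haA.1.trans haρ
    rw [hd2 ρ hρ]
    exact mul_nonneg hC.le (div_nonneg
      (Polynomial.rateNumerator_eval_nonneg hV haA.1 haρ haA.2) (hS ρ hρ).le)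
end

section
/- Let R, C, μ > 0, let n ≥ 1 be an integer, let 0 ≤ a < m < b and 0 < d < 2(m−a)(b−m)/(b−a). Then inf_{P ∈ 𝒫(a,b,m,d)} ∫ f_n(ρ) dP(ρ) = sup{ αd + βm + γ : α, β, γ ∈ ℝ such that α|ρ−m| + βρ + γ ≤ f_n(ρ) for all ρ ∈ [a,b] }, both the infimum and the supremum are attained, and any optimal probability measure P* and any optimal triple (α*, β*, γ*) satisfy the complementary slackness condition: f_n(ρ) = α*|ρ−m| + β*ρ + γ* for P*-almost every ρ ∈ [a,b]. -/
open MeasureTheory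

/-- The MAD ambiguity set: Borel probability measures supported on `[a,b]`
with mean `m` and mean-absolute deviation `d`. -/
def MADSet (a b m d : ℝ) : Set (Measure ℝ) :=
  {P | IsProbabilityMeasure P ∧ P (Set.Icc a b)ᶜ = 0 ∧
    (∫ ρ, ρ ∂P) = m ∧ (∫ ρ, |ρ - m| ∂P) = d}

/-- The probability measures on `ℝ` carried by the interval `[a,b]`. -/
def probOnIcc (a b : ℝ) : Set (Measure ℝ) :=
  {P | IsProbabilityMeasure P ∧ P (Set.Icc a b)ᶜ = 0}

lemma ae_mem_of_mem_probOnIcc {a b : ℝ} {P : Measure ℝ} (hP : P ∈ probOnIcc a b) :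
    ∀ᵐ ρ ∂P, ρ ∈ Set.Icc a b :=
  mem_ae_iff.2 hP.2

lemma integrable_of_mem_probOnIcc {a b : ℝ} {P : Measure ℝ} (hP : P ∈ probOnIcc a b)
    {f : ℝ → ℝ} (hf : ContinuousOn f (Set.Icc a b)) : Integrable f P := by
  have := hP.1
  have h : IntegrableOn f (Set.Icc a b) P := hf.integrableOn_compact isCompact_Icc
  rwa [IntegrableOn, Measure.restrict_eq_self_of_ae_mem (ae_mem_of_mem_probOnIcc hP)] at h

lemma dirac_mem_probOnIcc {a b x : ℝ} (hx : x ∈ Set.Icc a b) :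
    Measure.dirac x ∈ probOnIcc a b :=
  ⟨inferInstance, by simp [Measure.dirac_apply' _ measurableSet_Icc.compl, hx]⟩

lemma combo_mem_probOnIcc {a b : ℝ} {P Q : Measure ℝ} (hP : P ∈ probOnIcc a b)
    (hQ : Q ∈ probOnIcc a b) {s t : ℝ} (hs : 0 ≤ s) (ht : 0 ≤ t) (hst : s + t = 1) :
    ENNReal.ofReal s • P + ENNReal.ofReal t • Q ∈ probOnIcc a b := by
  have := hP.1
  have := hQ.1
  refine ⟨⟨?_⟩, ?_⟩
  · simp [← ENNReal.ofReal_add hs ht, hst]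
  · simp [hP.2, hQ.2]

lemma integral_ofReal_combo {P Q : Measure ℝ} {s t : ℝ} (hs : 0 ≤ s) (ht : 0 ≤ t) {f : ℝ → ℝ}
    (hP : Integrable f P) (hQ : Integrable f Q) :
    ∫ ρ, f ρ ∂(ENNReal.ofReal s • P + ENNReal.ofReal t • Q) =
      s * (∫ ρ, f ρ ∂P) + t * ∫ ρ, f ρ ∂Q := by
  rw [integral_add_measure (hP.smul_measure ENNReal.ofReal_ne_top)
    (hQ.smul_measure ENNReal.ofReal_ne_top), integral_smul_measure, integral_smul_measure,
    ENNReal.toReal_ofReal hs, ENNReal.toReal_ofReal ht, smul_eq_mul, smul_eq_mul]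

/-- On a compact space the integral of a continuous function attains its minimum under finitely
many moment constraints, here two. -/
lemma exists_isMinOn_integral {X : Type*} [TopologicalSpace X] [CompactSpace X]
    [TopologicalSpace.MetrizableSpace X] [MeasurableSpace X] [BorelSpace X]
    (f u v : C(X, ℝ)) (x y : ℝ)
    (hne : ∃ Q : ProbabilityMeasure X, ∫ ω, u ω ∂(Q : Measure X) = x ∧
      ∫ ω, v ω ∂(Q : Measure X) = y) :
    ∃ Q ∈ {Q : ProbabilityMeasure X | ∫ ω, u ω ∂(Q : Measure X) = x ∧
      ∫ ω, v ω ∂(Q : Measure X) = y},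
      IsMinOn (fun Q : ProbabilityMeasure X => ∫ ω, f ω ∂(Q : Measure X))
        {Q : ProbabilityMeasure X | ∫ ω, u ω ∂(Q : Measure X) = x ∧
          ∫ ω, v ω ∂(Q : Measure X) = y} Q := by
  have hcont (g : C(X, ℝ)) :
      Continuous fun Q : ProbabilityMeasure X => ∫ ω, g ω ∂(Q : Measure X) :=
    ProbabilityMeasure.continuous_integral_boundedContinuousFunction
      (BoundedContinuousFunction.mkOfCompact g)
  have hclosed : IsClosed {Q : ProbabilityMeasure X | ∫ ω, u ω ∂(Q : Measure X) = x ∧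
      ∫ ω, v ω ∂(Q : Measure X) = y} :=
    (isClosed_eq (hcont u) continuous_const).inter (isClosed_eq (hcont v) continuous_const)
  exact hclosed.isCompact.exists_isMinOn hne (hcont f).continuousOn

lemma exists_minimizer_MADSet {a b m d : ℝ} {f : ℝ → ℝ} (hf : ContinuousOn f (Set.Icc a b))
    (hne : (MADSet a b m d).Nonempty) :
    ∃ P ∈ MADSet a b m d, ∀ Q ∈ MADSet a b m d, ∫ ρ, f ρ ∂P ≤ ∫ ρ, f ρ ∂Q := by
  have hval : MeasurableEmbedding (Subtype.val : Set.Icc a b → ℝ) :=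
    MeasurableEmbedding.subtype_coe measurableSet_Icc
  let u : C(Set.Icc a b, ℝ) := ⟨fun ω => |(ω : ℝ) - m|, by fun_prop⟩
  let v : C(Set.Icc a b, ℝ) := ⟨fun ω => (ω : ℝ), by fun_prop⟩
  let g : C(Set.Icc a b, ℝ) := ⟨fun ω => f ω, hf.domRestrict⟩
  have hdown : ∀ P ∈ MADSet a b m d, ∃ Q : ProbabilityMeasure (Set.Icc a b),
      (Q : Measure (Set.Icc a b)).map Subtype.val = P := by
    rintro P ⟨hP, hPK, -, -⟩
    have hmap : (P.comap (Subtype.val : Set.Icc a b → ℝ)).map Subtype.val = P := by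
      rw [hval.map_comap, Subtype.range_coe]
      exact Measure.restrict_eq_self_of_ae_mem (mem_ae_iff.2 hPK)
    have : IsProbabilityMeasure (P.comap (Subtype.val : Set.Icc a b → ℝ)) := by
      rw [← Measure.isProbabilityMeasure_map_iff hval.measurable.aemeasurable, hmap]
      exact hP
    exact ⟨⟨_, this⟩, hmap⟩
  have hmoments : ∀ Q : ProbabilityMeasure (Set.Icc a b),
      (Q : Measure (Set.Icc a b)).map Subtype.val ∈ MADSet a b m d ↔
        ∫ ω, u ω ∂(Q : Measure (Set.Icc a b)) = d ∧
          ∫ ω, v ω ∂(Q : Measure (Set.Icc a b)) = m := by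
    intro Q
    have h1 : IsProbabilityMeasure ((Q : Measure (Set.Icc a b)).map Subtype.val) :=
      Measure.isProbabilityMeasure_map hval.measurable.aemeasurable
    have h2 : (Q : Measure (Set.Icc a b)).map Subtype.val (Set.Icc a b)ᶜ = 0 := by
      rw [hval.map_apply]
      simp
    simp only [MADSet, Set.mem_ofPred_eq, h1, h2, true_and, hval.integral_map]
    exact and_comm
  obtain ⟨P₀, hP₀⟩ := hne
  obtain ⟨Q₀, rfl⟩ := hdown P₀ hP₀
  obtain ⟨Q, hQ, hmin⟩ := exists_isMinOn_integral g u v d m ⟨Q₀, (hmoments Q₀).1 hP₀⟩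
  refine ⟨_, (hmoments Q).2 hQ, fun P hP => ?_⟩
  obtain ⟨Q', rfl⟩ := hdown P hP
  rw [hval.integral_map, hval.integral_map]
  exact hmin ((hmoments Q').1 hP)

/-- The triples `(x, y, z)` such that `x`, `y` are the values of the moment constraints and `z`
bounds the objective from above, for some probability measure on `[a,b]`. -/
def momentEpigraph (a b m : ℝ) (f : ℝ → ℝ) : Set (ℝ × ℝ × ℝ) :=
  {p | ∃ P ∈ probOnIcc a b, ∫ ρ, |ρ - m| ∂P = p.1 ∧ ∫ ρ, ρ ∂P = p.2.1 ∧ ∫ ρ, f ρ ∂P ≤ p.2.2}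

lemma convex_momentEpigraph {a b m : ℝ} {f : ℝ → ℝ} (hf : ContinuousOn f (Set.Icc a b)) :
    Convex ℝ (momentEpigraph a b m f) := by
  rintro ⟨x, y, z⟩ ⟨P, hP, h1, h2, h3⟩ ⟨x', y', z'⟩ ⟨Q, hQ, h1', h2', h3'⟩ s t hs ht hst
  have key {g : ℝ → ℝ} (hg : ContinuousOn g (Set.Icc a b)) :=
    integral_ofReal_combo hs ht (integrable_of_mem_probOnIcc hP hg)
      (integrable_of_mem_probOnIcc hQ hg)
  refine ⟨_, combo_mem_probOnIcc hP hQ hs ht hst, ?_, ?_, ?_⟩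
  · rw [key (by fun_prop), h1, h1']
    simp
  · rw [key (by fun_prop), h2, h2']
    simp
  · rw [key hf]
    simp only [Prod.smul_mk, Prod.mk_add_mk, smul_eq_mul]
    exact add_le_add (mul_le_mul_of_nonneg_left h3 hs) (mul_le_mul_of_nonneg_left h3' ht)

lemma mem_momentEpigraph_of_mem_Icc {a b m x z : ℝ} {f : ℝ → ℝ} (hx : x ∈ Set.Icc a b)
    (hz : f x ≤ z) : (|x - m|, x, z) ∈ momentEpigraph a b m f :=
  ⟨_, dirac_mem_probOnIcc hx, by simp, by simp, by simpa⟩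

lemma mem_interior_momentEpigraph {a b m d M z : ℝ} {f : ℝ → ℝ} (ham : a < m) (hmb : m < b)
    (hd0 : 0 < d) (hd : d < 2 * (m - a) * (b - m) / (b - a))
    (hf : ContinuousOn f (Set.Icc a b)) (hM : ∀ ρ ∈ Set.Icc a b, f ρ ≤ M) (hz : M < z) :
    (d, m, z) ∈ interior (momentEpigraph a b m f) := by
  let O : Set (ℝ × ℝ × ℝ) := {p | 0 < p.1 - p.2.1 + m ∧ 0 < p.1 + p.2.1 - m ∧
    (p.1 - p.2.1 + m) / (2 * (m - a)) + (p.1 + p.2.1 - m) / (2 * (b - m)) < 1 ∧ M < p.2.2}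
  have hma : 0 < m - a := sub_pos.2 ham
  have hbm : 0 < b - m := sub_pos.2 hmb
  have hO : IsOpen O := by
    refine IsOpen.and (isOpen_lt ?_ ?_) (IsOpen.and (isOpen_lt ?_ ?_)
      (IsOpen.and (isOpen_lt ?_ ?_) (isOpen_lt ?_ ?_))) <;> fun_prop
  refine mem_interior.2 ⟨O, ?_, hO, ?_⟩
  · rintro ⟨x, y, w⟩ ⟨h1, h2, h3, h4⟩
    simp only at h1 h2 h3 h4
    set p := (x - y + m) / (2 * (m - a)) with hp
    set q := (x + y - m) / (2 * (b - m)) with hq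
    have hp0 : 0 ≤ p := by positivity
    have hq0 : 0 ≤ q := by positivity
    have ha : a ∈ Set.Icc a b := ⟨le_rfl, by linarith⟩
    have hm : m ∈ Set.Icc a b := ⟨by linarith, by linarith⟩
    have hb : b ∈ Set.Icc a b := ⟨by linarith, le_rfl⟩
    have mem {c : ℝ} (hc : c ∈ Set.Icc a b) : (|c - m|, c, w) ∈ momentEpigraph a b m f :=
      mem_momentEpigraph_of_mem_Icc hc ((hM c hc).trans h4.le)
    have hsum := (convex_momentEpigraph (m := m) hf).sum_mem (t := Finset.univ)
      (w := ![p, 1 - p - q, q])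
      (z := ![(|a - m|, a, w), (|m - m|, m, w), (|b - m|, b, w)])
      (by intro i _; fin_cases i <;> simp <;> linarith)
      (by simp [Fin.sum_univ_three]; ring)
      (by intro i _; fin_cases i; exacts [mem ha, mem hm, mem hb])
    have hpe : p * (m - a) = (x - y + m) / 2 := by rw [hp]; field_simp
    have hqe : q * (b - m) = (x + y - m) / 2 := by rw [hq]; field_simp
    convert hsum using 1
    simp only [Fin.sum_univ_three, Matrix.cons_val_zero, Matrix.cons_val_one, Matrix.cons_val,
      Prod.smul_mk, Prod.mk_add_mk, smul_eq_mul, Prod.mk.injEq, abs_of_pos hbm,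
      abs_of_neg (sub_neg.2 ham), sub_self, abs_zero]
    exact ⟨by linarith, by linarith, by ring⟩
  · refine ⟨by simpa using hd0, by simpa using hd0, ?_, hz⟩
    rw [lt_div_iff₀ (by linarith)] at hd
    simp only [sub_add_cancel, add_sub_cancel_right]
    rw [div_add_div _ _ (by positivity) (by positivity), div_lt_one (by positivity)]
    nlinarith

lemma MADSet_nonempty {a b m d : ℝ} (ham : a < m) (hmb : m < b)
    (hd0 : 0 < d) (hd : d < 2 * (m - a) * (b - m) / (b - a)) : (MADSet a b m d).Nonempty := by
  obtain ⟨P, hP, h1, h2, -⟩ := interior_subset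
    (mem_interior_momentEpigraph (f := fun _ => 0) ham hmb hd0 hd continuousOn_const
      (fun _ _ => le_rfl) one_pos)
  exact ⟨P, hP.1, hP.2, h2, h1⟩

/-- A lower bound `v` for the primal problem is the value of some dual feasible triple. -/
lemma exists_dual_of_le_integral {a b m d v : ℝ} {f : ℝ → ℝ} (ham : a < m) (hmb : m < b)
    (hd0 : 0 < d) (hd : d < 2 * (m - a) * (b - m) / (b - a))
    (hf : ContinuousOn f (Set.Icc a b)) (hv : ∀ P ∈ MADSet a b m d, v ≤ ∫ ρ, f ρ ∂P) :
    ∃ α β γ : ℝ, (∀ ρ ∈ Set.Icc a b, α * |ρ - m| + β * ρ + γ ≤ f ρ) ∧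
      α * d + β * m + γ = v := by
  have hconv := convex_momentEpigraph (m := m) hf
  obtain ⟨M, hM⟩ := (isCompact_Icc.image_of_continuousOn hf).bddAbove
  replace hM : ∀ ρ ∈ Set.Icc a b, f ρ ≤ M := fun ρ hρ => hM ⟨ρ, hρ, rfl⟩
  set z := max M v + 1 with hz
  have hMz : M < z := by linarith [le_max_left M v]
  have hvz : v < z := by linarith [le_max_right M v]
  have hint := mem_interior_momentEpigraph ham hmb hd0 hd hf hM hMz
  have hnot : (d, m, v) ∉ interior (momentEpigraph a b m f) := by
    intro h
    have hcont : Continuous fun w : ℝ => ((d, m, w) : ℝ × ℝ × ℝ) := by fun_prop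
    obtain ⟨ε, hε, hball⟩ := Metric.isOpen_iff.1 (isOpen_interior.preimage hcont) v h
    obtain ⟨P, hP, h1, h2, h3⟩ := interior_subset
      (hball (show v - ε / 2 ∈ Metric.ball v ε by
        rw [Metric.mem_ball, Real.dist_eq, abs_lt]; constructor <;> linarith))
    have := hv P ⟨hP.1, hP.2, h2, h1⟩
    simp only at h3
    linarith
  obtain ⟨L, hL⟩ := geometric_hahn_banach_open_point hconv.interior isOpen_interior hnot
  set α := L (1, 0, 0)
  set β := L (0, 1, 0)
  set c := L (0, 0, 1)
  have hLapp (x y w : ℝ) : L (x, y, w) = x * α + y * β + w * c := by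
    have : ((x, y, w) : ℝ × ℝ × ℝ) =
        x • ((1, 0, 0) : ℝ × ℝ × ℝ) + y • ((0, 1, 0) : ℝ × ℝ × ℝ) +
          w • ((0, 0, 1) : ℝ × ℝ × ℝ) := by simp
    rw [this, map_add, map_add, map_smul, map_smul, map_smul]
    rfl
  have hLle : ∀ p ∈ momentEpigraph a b m f, L p ≤ L (d, m, v) := by
    have hsub : closure (interior (momentEpigraph a b m f)) ⊆ {p | L p ≤ L (d, m, v)} :=
      closure_minimal (fun p hp => (hL p hp).le) (isClosed_le L.continuous continuous_const)
    rw [hconv.closure_interior_eq_closure_of_nonempty_interior ⟨_, hint⟩] at hsub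
    exact fun p hp => hsub (subset_closure hp)
  have hc : c < 0 := by
    have := hL _ hint
    rw [hLapp, hLapp] at this
    nlinarith
  refine ⟨-α / c, -β / c, v - -α / c * d - -β / c * m, fun ρ hρ => ?_, by ring⟩
  have h := hLle _ (mem_momentEpigraph_of_mem_Icc (m := m) hρ le_rfl)
  rw [hLapp, hLapp] at h
  have key : -α / c * |ρ - m| + -β / c * ρ + (v - -α / c * d - -β / c * m) =
      v + ((d * α + m * β) - (|ρ - m| * α + ρ * β)) / c := by
    field_simp
    ring
  rw [key, ← le_sub_iff_add_le', div_le_iff_of_neg hc]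
  linarith

lemma integral_dual {a b m d α β γ : ℝ} {P : Measure ℝ} (hP : P ∈ MADSet a b m d) :
    ∫ ρ, (α * |ρ - m| + β * ρ + γ) ∂P = α * d + β * m + γ := by
  have := hP.1
  have hP' : P ∈ probOnIcc a b := ⟨hP.1, hP.2.1⟩
  have h1 : Integrable (fun ρ => α * |ρ - m|) P :=
    integrable_of_mem_probOnIcc hP' (by fun_prop)
  have h2 : Integrable (fun ρ => β * ρ) P := integrable_of_mem_probOnIcc hP' (by fun_prop)
  have h12 : Integrable (fun ρ => α * |ρ - m| + β * ρ) P := h1.add h2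
  rw [integral_add h12 (integrable_const γ), integral_add h1 h2, integral_const_mul,
    integral_const_mul, hP.2.2.1, hP.2.2.2]
  simp

lemma dual_le_integral {a b m d α β γ : ℝ} {f : ℝ → ℝ} {P : Measure ℝ}
    (hf : ContinuousOn f (Set.Icc a b)) (hP : P ∈ MADSet a b m d)
    (hfeas : ∀ ρ ∈ Set.Icc a b, α * |ρ - m| + β * ρ + γ ≤ f ρ) :
    α * d + β * m + γ ≤ ∫ ρ, f ρ ∂P := by
  have hP' : P ∈ probOnIcc a b := ⟨hP.1, hP.2.1⟩
  rw [← integral_dual hP]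
  exact integral_mono_ae (integrable_of_mem_probOnIcc hP' (by fun_prop))
    (integrable_of_mem_probOnIcc hP' hf) ((ae_mem_of_mem_probOnIcc hP').mono hfeas)

lemma ae_eq_dual_of_integral_eq {a b m d α β γ : ℝ} {f : ℝ → ℝ} {P : Measure ℝ}
    (hf : ContinuousOn f (Set.Icc a b)) (hP : P ∈ MADSet a b m d)
    (hfeas : ∀ ρ ∈ Set.Icc a b, α * |ρ - m| + β * ρ + γ ≤ f ρ)
    (heq : ∫ ρ, f ρ ∂P = α * d + β * m + γ) :
    ∀ᵐ ρ ∂P, f ρ = α * |ρ - m| + β * ρ + γ := by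
  have hP' : P ∈ probOnIcc a b := ⟨hP.1, hP.2.1⟩
  have hfi := integrable_of_mem_probOnIcc hP' hf
  have hgi : Integrable (fun ρ => α * |ρ - m| + β * ρ + γ) P :=
    integrable_of_mem_probOnIcc hP' (by fun_prop)
  have hle : (fun ρ => α * |ρ - m| + β * ρ + γ) ≤ᵐ[P] f :=
    (ae_mem_of_mem_probOnIcc hP').mono hfeas
  filter_upwards [(integral_eq_iff_of_ae_le hgi hfi hle).1 (by rw [integral_dual hP, heq])]
    with ρ hρ using hρ.symm

/-- The social benefit rate in terms of the stationary distribution `ρ ^ k / ∑ i ≤ n, ρ ^ i`. -/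
lemma socialRate_eq_sum (R C μ : ℝ) (n : ℕ) {ρ : ℝ} (hρ : 0 ≤ ρ) :
    socialRate R C μ n ρ =
      (R * μ * (ρ * ∑ k ∈ Finset.range n, ρ ^ k) -
        C * ∑ k ∈ Finset.range (n + 1), (k : ℝ) * ρ ^ k) /
          ∑ k ∈ Finset.range (n + 1), ρ ^ k := by
  rcases eq_or_ne ρ 1 with rfl | hρ1
  · have hn : (n : ℝ) + 1 ≠ 0 := by positivity
    have hsum : ∑ k ∈ Finset.range (n + 1), (k : ℝ) = n * (n + 1) / 2 := by
      induction n with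
      | zero => simp
      | succ k ih =>
        rw [Finset.sum_range_succ, ih (by positivity)]
        push_cast
        ring
    simp only [socialRate, if_true, one_pow, mul_one, hsum, Finset.sum_const, Finset.card_range,
      nsmul_eq_mul, one_mul]
    push_cast
    field_simp
  · have h1 : 1 - ρ ≠ 0 := sub_ne_zero.2 hρ1.symm
    have hne : 1 - ρ ^ (n + 1) ≠ 0 :=
      sub_ne_zero.2 fun h => hρ1 ((pow_eq_one_iff_of_nonneg hρ n.succ_ne_zero).1 h.symm)
    have hgeom (k : ℕ) : ∑ i ∈ Finset.range k, ρ ^ i = (1 - ρ ^ k) / (1 - ρ) := by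
      rw [eq_div_iff h1, geom_sum_mul_neg]
    have hweighted (N : ℕ) : ∑ k ∈ Finset.range (N + 1), (k : ℝ) * ρ ^ k =
        (ρ * (1 - ρ ^ (N + 1)) - (N + 1) * ρ ^ (N + 1) * (1 - ρ)) / (1 - ρ) ^ 2 := by
      induction N with
      | zero =>
        simp
      | succ k ih =>
        rw [Finset.sum_range_succ, ih]
        push_cast
        field_simp
        ring
    rw [socialRate, if_neg hρ1, hweighted, hgeom, hgeom]
    field_simp

lemma continuousOn_socialRate (R C μ : ℝ) (n : ℕ) {a b : ℝ} (ha : 0 ≤ a) :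
    ContinuousOn (socialRate R C μ n) (Set.Icc a b) := by
  refine ContinuousOn.congr (ContinuousOn.div (by fun_prop) (by fun_prop) fun ρ hρ => ?_)
    fun ρ hρ => socialRate_eq_sum R C μ n (ha.trans hρ.1)
  have : 0 ≤ ρ := ha.trans hρ.1
  rw [Finset.sum_range_succ']
  positivity

/-- Strong duality, attainment and complementary slackness for the worst-case
expected social benefit rate over the MAD ambiguity set. -/
theorem stmt5 (R C μ : ℝ) (hR : 0 < R) (hC : 0 < C) (hμ : 0 < μ)
    (n : ℕ) (hn : 1 ≤ n)
    (a b m d : ℝ) (ha : 0 ≤ a) (ham : a < m) (hmb : m < b)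
    (hd0 : 0 < d) (hd : d < 2 * (m - a) * (b - m) / (b - a)) :
    let primal : ℝ := sInf ((fun P => ∫ ρ, socialRate R C μ n ρ ∂P) '' MADSet a b m d)
    let dualFeas : ℝ × ℝ × ℝ → Prop := fun p =>
      ∀ ρ ∈ Set.Icc a b, p.1 * |ρ - m| + p.2.1 * ρ + p.2.2 ≤ socialRate R C μ n ρ
    let dualVal : ℝ × ℝ × ℝ → ℝ := fun p => p.1 * d + p.2.1 * m + p.2.2
    primal = sSup (dualVal '' {p | dualFeas p}) ∧
    (∃ P ∈ MADSet a b m d, (∫ ρ, socialRate R C μ n ρ ∂P) = primal) ∧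
    (∃ p : ℝ × ℝ × ℝ, dualFeas p ∧ dualVal p = primal) ∧
    (∀ P ∈ MADSet a b m d, (∫ ρ, socialRate R C μ n ρ ∂P) = primal →
      ∀ p : ℝ × ℝ × ℝ, dualFeas p → dualVal p = primal →
        ∀ᵐ ρ ∂P, ρ ∈ Set.Icc a b →
          socialRate R C μ n ρ = p.1 * |ρ - m| + p.2.1 * ρ + p.2.2) := by
  intro primal dualFeas dualVal
  have hf := continuousOn_socialRate R C μ n (b := b) ha
  obtain ⟨P, hP, hmin⟩ := exists_minimizer_MADSet hf (MADSet_nonempty ham hmb hd0 hd)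
  have hprimal : ∫ ρ, socialRate R C μ n ρ ∂P = primal := by
    refine (IsLeast.csInf_eq ?_).symm
    exact ⟨⟨P, hP, rfl⟩, Set.forall_mem_image.2 hmin⟩
  obtain ⟨α, β, γ, hfeas, hval⟩ :=
    exists_dual_of_le_integral ham hmb hd0 hd hf (hprimal ▸ hmin)
  have hgreatest : IsGreatest (dualVal '' {p | dualFeas p}) primal := by
    refine ⟨⟨(α, β, γ), hfeas, hval⟩, Set.forall_mem_image.2 fun p hp => ?_⟩
    exact hprimal ▸ dual_le_integral hf hP hp
  refine ⟨hgreatest.csSup_eq.symm, ⟨P, hP, hprimal⟩,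
    ⟨(α, β, γ), hfeas, hval⟩, fun Q hQ hQe p hp hpe => ?_⟩
  filter_upwards [ae_eq_dual_of_integral_eq hf hQ hp (hQe.trans hpe.symm)] with ρ hρ _ using hρ
end

section
/- Let R, C, μ > 0, let n ≥ 1 be an integer with Rμ/C ≥ n + 1, let 0 ≤ a < m < b with m ≤ 1, and let 0 < d < 2(m−a)(b−m)/(b−a). If f_n(b) + f_n'(b)(m−b) ≥ f_n(m), then inf_{P ∈ 𝒫(a,b,m,d)} ∫ f_n(ρ) dP(ρ) = (d/(2(m−a)))·f_n(a) + (1 − d/(2(m−a)) − d/(2(b−m)))·f_n(m) + (d/(2(b−m)))·f_n(b), and the infimum is attained by the three-point probability measure placing masses d/(2(m−a)), 1 − d/(2(m−a)) − d/(2(b−m)), and d/(2(b−m)) at a, m, and b respectively. -/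
open MeasureTheory

section Curvature

open Finset

/-- Closed form of `∑ q k * x ^ k` for a sequence `q` with vanishing sixth differences. -/
theorem sixth_difference_sum (q : ℕ → ℝ) (x : ℝ)
    (hq : ∀ k, q (k + 6) = 6 * q (k + 5) - 15 * q (k + 4) + 20 * q (k + 3) - 15 * q (k + 2)
      + 6 * q (k + 1) - q k) (M : ℕ) :
    (1 - x) ^ 6 * ∑ k ∈ range M, q k * x ^ k =
      (fun G : ℕ → ℝ => G 0 - x ^ M * G M) (fun k =>
        q k * (1 - x) ^ 5 + (q (k + 1) - q k) * x * (1 - x) ^ 4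
        + (q (k + 2) - 2 * q (k + 1) + q k) * x ^ 2 * (1 - x) ^ 3
        + (q (k + 3) - 3 * q (k + 2) + 3 * q (k + 1) - q k) * x ^ 3 * (1 - x) ^ 2
        + (q (k + 4) - 4 * q (k + 3) + 6 * q (k + 2) - 4 * q (k + 1) + q k) * x ^ 4 * (1 - x)
        + (q (k + 5) - 5 * q (k + 4) + 10 * q (k + 3) - 10 * q (k + 2) + 5 * q (k + 1) - q k)
          * x ^ 5) := by
  induction M with
  | zero => simp
  | succ M ih =>
    rw [sum_range_succ, mul_add, ih]
    have := hq M
    simp only [show M + 1 + 1 = M + 2 by ring, show M + 1 + 2 = M + 3 by ring,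
      show M + 1 + 3 = M + 4 by ring, show M + 1 + 4 = M + 5 by ring,
      show M + 1 + 5 = M + 6 by ring, this]
    ring

/-- Coefficients of `x ^ k`, `k < p`, in `curvature p s x`. -/
noncomputable def lowCoeff (k : ℕ) : ℝ :=
  -(((k : ℝ) + 5) * (k + 4) * (k + 3) * (k + 2) * (k + 1))

/-- Coefficients of `x ^ (p + j)`, `j ≤ p`, in `curvature p s x`. -/
noncomputable def midCoeff (p : ℕ) (s : ℝ) (j : ℕ) : ℝ :=
  (2 * ((j : ℝ) + 1) - (p + 2)) *
    ((((j : ℝ) + 1) * (p + 1 - j)) ^ 2 + (7 * ((p : ℝ) + 2) ^ 2 + 5) * (((j : ℝ) + 1) * (p + 1 - j))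
      + (((p : ℝ) + 2) ^ 2 - 1) * (((p : ℝ) + 2) ^ 2 - 4))
  - (30 * ((p : ℝ) + 2) ^ 2 + 60 * s * (p + 2)) * (((j : ℝ) + 1) * (p + 1 - j))

/-- Coefficients of `x ^ (2 * p + 1 + l)`, `l < p`, in `curvature p s x`. -/
noncomputable def highCoeff (p l : ℕ) : ℝ :=
  ((p : ℝ) - l + 4) * (p - l + 3) * (p - l + 2) * (p - l + 1) * (p - l)

/-- The numerator of the second derivative of the social benefit rate for `n = p + 1` and
`R * μ / C = p + 2 + s`, normalized by `60`; see `curvature_eq`. -/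
noncomputable def curvature (p : ℕ) (s x : ℝ) : ℝ :=
  ∑ k ∈ range p, lowCoeff k * x ^ k + x ^ p * ∑ j ∈ range (p + 1), midCoeff p s j * x ^ j
    + x ^ (2 * p + 1) * ∑ l ∈ range p, highCoeff p l * x ^ l

theorem one_sub_pow_six_mul_curvature (p : ℕ) (s x : ℝ) :
    (1 - x) ^ 6 * curvature p s x =
      60 * ((1 - x) ^ 3 * (((p : ℝ) + 2) ^ 2 * x ^ (p + 1) * ((p + 3) + (p + 1) * x ^ (p + 2))
        + s * (p + 2) * x ^ p * (x * ((p + 3) + (p + 1) * x ^ (p + 2))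
          - ((p + 1) + (p + 3) * x ^ (p + 2)))) - 2 * (1 - x ^ (p + 2)) ^ 3) := by
  have h1 := sixth_difference_sum lowCoeff x (by intro k; simp only [lowCoeff]; push_cast; ring) p
  have h2 := sixth_difference_sum (midCoeff p s) x
    (by intro k; simp only [midCoeff]; push_cast; ring) (p + 1)
  have h3 := sixth_difference_sum (highCoeff p) x
    (by intro k; simp only [highCoeff]; push_cast; ring) p
  have : (1 - x) ^ 6 * curvature p s x =
    (1 - x) ^ 6 * ∑ k ∈ range p, lowCoeff k * x ^ k
    + x ^ p * ((1 - x) ^ 6 * ∑ j ∈ range (p + 1), midCoeff p s j * x ^ j)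
    + x ^ (2 * p + 1) * ((1 - x) ^ 6 * ∑ l ∈ range p, highCoeff p l * x ^ l) := by
    rw [curvature]; ring
  rw [this, h1, h2, h3]
  simp only [lowCoeff, midCoeff, highCoeff]
  push_cast
  have e1 : x ^ (2 * p + 1) = (x ^ p) ^ 2 * x := by ring
  have e2 : x ^ (p + 1) = x ^ p * x := by ring
  have e3 : x ^ (p + 2) = x ^ p * x ^ 2 := by ring
  rw [e1, e2, e3]
  generalize x ^ p = X
  generalize (p : ℝ) = t
  ring

/-- Once positive, the middle coefficients of `curvature` stay nonnegative. -/
theorem midCoeff_nonneg_of_pos {p i j : ℕ} {s : ℝ} (hij : i ≤ j) (hj : j ≤ p) (hs : 0 ≤ s)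
    (hi : 0 < midCoeff p s i) : 0 ≤ midCoeff p s j := by
  rcases hij.eq_or_lt with rfl | hlt
  · exact hi.le
  have hp : 1 ≤ p := by omega
  have hp' : (1 : ℝ) ≤ p := by exact_mod_cast hp
  have hij' : (i : ℝ) + 1 ≤ j := by exact_mod_cast hlt
  have hj' : (j : ℝ) ≤ p := by exact_mod_cast hj
  have hi0 : (0 : ℝ) ≤ i := i.cast_nonneg
  unfold midCoeff at hi ⊢
  set N : ℝ := (p : ℝ) + 2 with hN
  obtain ⟨v, hv⟩ : ∃ v : ℝ, v = (i : ℝ) + 1 := ⟨_, rfl⟩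
  obtain ⟨w, hw⟩ : ∃ w : ℝ, w = (j : ℝ) + 1 := ⟨_, rfl⟩
  have ei : (p : ℝ) + 1 - i = N - v := by rw [hN, hv]; ring
  have ej : (p : ℝ) + 1 - j = N - w := by rw [hN, hw]; ring
  rw [ei, ← hv] at hi
  rw [ej, ← hw]
  have hv1 : 1 ≤ v := by linarith
  have hvw : v < w := by linarith
  have hwN : w ≤ N - 1 := by linarith
  have hN3 : 3 ≤ N := by linarith
  have hY : 0 < v * (N - v) := mul_pos (by linarith) (by linarith)
  have hZ : 0 < w * (N - w) := mul_pos (by linarith) (by linarith)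
  have hY4 : v * (N - v) ≤ N ^ 2 / 4 := by nlinarith [sq_nonneg (2 * v - N)]
  have hZ4 : w * (N - w) ≤ N ^ 2 / 4 := by nlinarith [sq_nonneg (2 * w - N)]
  have hκ : 0 ≤ 30 * N ^ 2 + 60 * s * N := by positivity
  have hγ : N ^ 4 / 16 ≤ (N ^ 2 - 1) * (N ^ 2 - 4) := by
    nlinarith [mul_nonneg (sub_nonneg.2 hN3) (sub_nonneg.2 hN3), sq_nonneg (N ^ 2 - 9)]
  have hcmp : v * (N - v) - w * (N - w) = (w - v) * (v + w - N) := by ring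
  generalize 30 * N ^ 2 + 60 * s * N = κ at *
  generalize (N ^ 2 - 1) * (N ^ 2 - 4) = γ at *
  have hβ : 0 ≤ 7 * N ^ 2 + 5 := by positivity
  generalize 7 * N ^ 2 + 5 = β at *
  generalize v * (N - v) = Y at *
  generalize w * (N - w) = Z at *
  have hγ0 : 0 ≤ γ := le_trans (by positivity) hγ
  have hv2 : 0 < 2 * v - N := by
    by_contra! h
    have : (2 * v - N) * (Y ^ 2 + β * Y + γ) ≤ 0 :=
      mul_nonpos_of_nonpos_of_nonneg h (by positivity)
    have : 0 ≤ κ * Y := by positivity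
    linarith
  have hZY : Z ≤ Y := by
    have : 0 ≤ (w - v) * (v + w - N) := mul_nonneg (by linarith) (by linarith)
    linarith
  have hYZ : Y * Z ≤ γ := by
    have : Y * Z ≤ (N ^ 2 / 4) * (N ^ 2 / 4) := mul_le_mul hY4 hZ4 hZ.le (by positivity)
    nlinarith
  have h1 : Z * (Y ^ 2 + β * Y + γ) ≤ Y * (Z ^ 2 + β * Z + γ) := by
    nlinarith [mul_nonneg (sub_nonneg.2 hZY) (sub_nonneg.2 hYZ)]
  have h2 : (2 * v - N) * (Z * (Y ^ 2 + β * Y + γ)) ≤ (2 * w - N) * (Y * (Z ^ 2 + β * Z + γ)) :=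
    mul_le_mul (by linarith) h1 (by positivity) (by linarith)
  have h3 : 0 ≤ Y * ((2 * w - N) * (Z ^ 2 + β * Z + γ) - κ * Z) := by
    have := mul_pos hZ hi
    nlinarith
  exact nonneg_of_mul_nonneg_right h3 hY

theorem exists_midCoeff_sign_change (p : ℕ) {s : ℝ} (hs : 0 ≤ s) :
    ∃ J ≤ p + 1, (∀ j < J, midCoeff p s j ≤ 0) ∧ ∀ j ≤ p, J ≤ j → 0 ≤ midCoeff p s j := by
  classical
  by_cases h : ∃ j, j ≤ p ∧ 0 < midCoeff p s j
  · refine ⟨Nat.find h, by have := (Nat.find_spec h).1; omega, fun j hj => ?_, fun j hj hJ =>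
      midCoeff_nonneg_of_pos hJ hj hs (Nat.find_spec h).2⟩
    have := (Nat.find_spec h).1
    by_contra! hc
    exact Nat.find_min h hj ⟨by omega, hc⟩
  · push Not at h
    exact ⟨p + 1, le_rfl, fun j hj => h j (by omega), fun j hj hJ => by omega⟩

theorem pow_mul_pow_le_pow_mul_pow {x y : ℝ} (hx : 0 ≤ x) (hxy : x ≤ y) {k K : ℕ} (hk : k ≤ K) :
    y ^ k * x ^ K ≤ x ^ k * y ^ K := by
  obtain ⟨l, rfl⟩ := Nat.exists_eq_add_of_le hk
  have h := pow_le_pow_left₀ hx hxy l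
  have h2 : 0 ≤ x ^ k * y ^ k := mul_nonneg (pow_nonneg hx k) (pow_nonneg (hx.trans hxy) k)
  rw [pow_add, pow_add]
  nlinarith [mul_le_mul_of_nonneg_left h h2]

theorem lowCoeff_nonpos (k : ℕ) : lowCoeff k ≤ 0 := by
  unfold lowCoeff
  have : (0 : ℝ) ≤ k := k.cast_nonneg
  exact neg_nonpos.2 (by positivity)

theorem highCoeff_nonneg {p l : ℕ} (hl : l < p) : 0 ≤ highCoeff p l := by
  unfold highCoeff
  have : (0 : ℝ) ≤ p - l := sub_nonneg.2 (by exact_mod_cast hl.le)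
  positivity

theorem curvature_nonpos_of_le {p : ℕ} {s x y : ℝ} (hs : 0 ≤ s) (hx : 0 < x) (hxy : x ≤ y)
    (hy : curvature p s y ≤ 0) : curvature p s x ≤ 0 := by
  obtain ⟨J, hJ, hneg, hpos⟩ := exists_midCoeff_sign_change p hs
  have hy0 : 0 < y := hx.trans_le hxy
  have hle {c : ℝ} {k K : ℕ} (hk : k ≤ K) (hc : c ≤ 0) :
      c * (x ^ k * y ^ K) ≤ c * (y ^ k * x ^ K) :=
    mul_le_mul_of_nonpos_left (pow_mul_pow_le_pow_mul_pow hx.le hxy hk) hc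
  have hge {c : ℝ} {k K : ℕ} (hk : K ≤ k) (hc : 0 ≤ c) :
      c * (x ^ k * y ^ K) ≤ c * (y ^ k * x ^ K) := by
    have := mul_le_mul_of_nonneg_left (pow_mul_pow_le_pow_mul_pow hx.le hxy hk) hc
    linarith
  have key : curvature p s x * y ^ (p + J) ≤ curvature p s y * x ^ (p + J) := by
    simp only [curvature, add_mul, mul_sum, sum_mul]
    refine add_le_add (add_le_add (sum_le_sum fun k hk => ?_) (sum_le_sum fun j hj => ?_))
      (sum_le_sum fun l hl => ?_)
    · rw [mem_range] at hk
      have := hle (k := k) (K := p + J) (by omega) (lowCoeff_nonpos k)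
      linarith
    · rw [mem_range] at hj
      have e (t u : ℝ) : t ^ p * (midCoeff p s j * t ^ j) * u ^ (p + J)
          = midCoeff p s j * (t ^ (p + j) * u ^ (p + J)) := by ring
      rw [e, e]
      rcases lt_or_ge j J with h | h
      · exact hle (by omega) (hneg j h)
      · exact hge (by omega) (hpos j (by omega) h)
    · rw [mem_range] at hl
      have e (t u : ℝ) : t ^ (2 * p + 1) * (highCoeff p l * t ^ l) * u ^ (p + J)
          = highCoeff p l * (t ^ (2 * p + 1 + l) * u ^ (p + J)) := by ring
      rw [e, e]
      exact hge (by omega) (highCoeff_nonneg hl)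
  have h1 : curvature p s y * x ^ (p + J) ≤ 0 :=
    mul_nonpos_of_nonpos_of_nonneg hy (by positivity)
  exact nonpos_of_mul_nonpos_left (key.trans h1) (by positivity)

theorem curvature_one_nonpos (p : ℕ) {s : ℝ} (hs : 0 ≤ s) : curvature p s 1 ≤ 0 := by
  have h1 : ∑ k ∈ range p, lowCoeff k + ∑ l ∈ range p, highCoeff p l = 0 := by
    rw [← sum_range_reflect (highCoeff p), ← sum_add_distrib]
    refine sum_eq_zero fun k hk => ?_
    rw [mem_range] at hk
    have : ((p - 1 - k : ℕ) : ℝ) = p - 1 - k := by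
      rw [Nat.cast_sub (by omega), Nat.cast_sub (by omega)]; simp
    simp only [lowCoeff, highCoeff, this]
    ring
  have h2 : ∑ j ∈ range (p + 1), midCoeff p s j + ∑ j ∈ range (p + 1), midCoeff p s j ≤ 0 := by
    nth_rewrite 1 [← sum_range_reflect (midCoeff p s)]
    rw [← sum_add_distrib]
    refine sum_nonpos fun k hk => ?_
    rw [mem_range] at hk
    have hk' : (k : ℝ) ≤ p := by exact_mod_cast Nat.lt_succ_iff.1 hk
    have : ((p + 1 - 1 - k : ℕ) : ℝ) = p - k := by
      rw [Nat.add_sub_cancel, Nat.cast_sub (by omega)]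
    have e : midCoeff p s (p + 1 - 1 - k) + midCoeff p s k
        = -(2 * (30 * ((p : ℝ) + 2) ^ 2 + 60 * s * (p + 2)) * (((k : ℝ) + 1) * (p + 1 - k))) := by
      simp only [midCoeff, this]
      ring
    rw [e]
    have : (0 : ℝ) ≤ p + 1 - k := by linarith
    exact neg_nonpos.2 (by positivity)
  simp only [curvature, one_pow, mul_one, one_mul]
  linarith

theorem continuous_curvature (p : ℕ) (s : ℝ) : Continuous (curvature p s) := by
  unfold curvature
  fun_prop

/-- The partition function `1 + ρ + ⋯ + ρ ^ (p + 1)` of the queue with `p + 2` states. -/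
noncomputable def partitionPoly (p : ℕ) : Polynomial ℝ := ∑ k ∈ range (p + 2), Polynomial.X ^ k

/-- The numerator of the social benefit rate over `partitionPoly p`, in units of `C`, when
`R * μ / C = p + 2 + s`. -/
noncomputable def benefitPoly (p : ℕ) (s : ℝ) : Polynomial ℝ :=
  Polynomial.C ((p : ℝ) + 2 + s) * (partitionPoly p - 1)
    - Polynomial.X * (partitionPoly p).derivative

theorem one_sub_X_mul_partitionPoly (p : ℕ) :
    (1 - Polynomial.X) * partitionPoly p = 1 - Polynomial.X ^ (p + 2) :=
  mul_neg_geom_sum _ _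

theorem one_sub_mul_partitionPoly_eval (p : ℕ) (x : ℝ) :
    (1 - x) * (partitionPoly p).eval x = 1 - x ^ (p + 2) := by
  simpa using congrArg (Polynomial.eval x) (one_sub_X_mul_partitionPoly p)

theorem one_sub_mul_partitionPoly_derivative_eval (p : ℕ) (x : ℝ) :
    (1 - x) * (partitionPoly p).derivative.eval x =
      (partitionPoly p).eval x - (p + 2) * x ^ (p + 1) := by
  have := congrArg (fun q => q.derivative.eval x) (one_sub_X_mul_partitionPoly p)
  simp at this
  linarith

theorem one_sub_mul_partitionPoly_derivative2_eval (p : ℕ) (x : ℝ) :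
    (1 - x) * (partitionPoly p).derivative.derivative.eval x =
      2 * (partitionPoly p).derivative.eval x - (p + 2) * (p + 1) * x ^ p := by
  have := congrArg (fun q => q.derivative.derivative.eval x) (one_sub_X_mul_partitionPoly p)
  simp at this
  linarith

theorem one_sub_mul_partitionPoly_derivative3_eval (p : ℕ) (x : ℝ) :
    (1 - x) * (x * (partitionPoly p).derivative.derivative.derivative.eval x) =
      3 * (x * (partitionPoly p).derivative.derivative.eval x)
        - (p + 2) * (p + 1) * p * x ^ p := by
  have := congrArg (fun q => q.derivative.derivative.derivative.eval x)
    (one_sub_X_mul_partitionPoly p)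
  have h : (p : ℝ) * x ^ p = p * x ^ (p - 1) * x := by
    cases p with
    | zero => simp
    | succ q => simp [pow_succ]; ring
  simp [Polynomial.derivative_X_pow] at this
  linear_combination x * this + (p + 2 : ℝ) * (p + 1) * h

theorem curvature_eq (p : ℕ) (s x : ℝ) :
    60 * (((benefitPoly p s).derivative.derivative.eval x * (partitionPoly p).eval x
        - (benefitPoly p s).eval x * (partitionPoly p).derivative.derivative.eval x)
          * (partitionPoly p).eval x
      - 2 * (partitionPoly p).derivative.eval x *
        ((benefitPoly p s).derivative.eval x * (partitionPoly p).eval x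
        - (benefitPoly p s).eval x * (partitionPoly p).derivative.eval x)) = curvature p s x := by
  revert x
  rw [← funext_iff]
  refine Continuous.ext_on (dense_compl_singleton (1 : ℝ)) (by fun_prop) (continuous_curvature p s)
    fun x hx => ?_
  have hy : 1 - x ≠ 0 := sub_ne_zero.2 (Ne.symm hx)
  refine mul_left_cancel₀ (pow_ne_zero 6 hy) ?_
  rw [one_sub_pow_six_mul_curvature]
  have e0 := one_sub_mul_partitionPoly_eval p x
  have e1 := one_sub_mul_partitionPoly_derivative_eval p x
  have e2 := one_sub_mul_partitionPoly_derivative2_eval p x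
  have e3 := one_sub_mul_partitionPoly_derivative3_eval p x
  simp only [benefitPoly, Polynomial.derivative_sub, Polynomial.derivative_mul,
    Polynomial.derivative_C, Polynomial.derivative_X, Polynomial.derivative_one,
    Polynomial.derivative_add,
    Polynomial.eval_sub, Polynomial.eval_mul, Polynomial.eval_add, Polynomial.eval_C,
    Polynomial.eval_X, Polynomial.eval_one, zero_mul, zero_add, sub_zero,
    one_mul]
  generalize (partitionPoly p).eval x = S at *
  generalize (partitionPoly p).derivative.eval x = S1 at *
  generalize (partitionPoly p).derivative.derivative.eval x = S2 at *
  generalize x * (partitionPoly p).derivative.derivative.derivative.eval x = T at *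
  have g1 : x ^ (p + 1) = x ^ p * x := pow_succ x p
  have g2 : x ^ (p + 2) = x ^ p * x ^ 2 := pow_add x p 2
  rw [g2] at e0
  rw [g1] at e1
  rw [g1, g2]
  clear g1 g2
  generalize x ^ p = u at *
  generalize (p : ℝ) = t at *
  have f0 : S = (1 - u * x ^ 2) / (1 - x) := by field_simp; linarith
  have f1 : S1 = (S - (t + 2) * (u * x)) / (1 - x) := by field_simp; linarith
  have f2 : S2 = (2 * S1 - (t + 2) * (t + 1) * u) / (1 - x) := by field_simp; linarith
  have f3 : T = (3 * (x * S2) - (t + 2) * (t + 1) * t * u) / (1 - x) := by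
    field_simp; linarith
  subst f3 f2 f1 f0
  field_simp
  ring

theorem one_le_partitionPoly_eval (p : ℕ) {x : ℝ} (hx : 0 ≤ x) : 1 ≤ (partitionPoly p).eval x := by
  rw [partitionPoly, Polynomial.eval_finsetSum, sum_range_succ']
  have : 0 ≤ ∑ k ∈ range (p + 1), Polynomial.eval x (Polynomial.X ^ (k + 1) : Polynomial ℝ) :=
    sum_nonneg fun k _ => by simpa using pow_nonneg hx _
  simpa using this

/-- On `[0, ∞)` the social benefit rate is a rational function without poles. -/
theorem socialRate_eq {R C μ : ℝ} (hC : 0 < C) (p : ℕ) {x : ℝ} (hx : 0 ≤ x) :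
    socialRate R C μ (p + 1) x = C *
      ((benefitPoly p (R * μ / C - (p + 2))).eval x / (partitionPoly p).eval x) := by
  have e0 := one_sub_mul_partitionPoly_eval p x
  have e1 := one_sub_mul_partitionPoly_derivative_eval p x
  have e2 := one_sub_mul_partitionPoly_derivative2_eval p x
  have hS := one_le_partitionPoly_eval p hx
  simp only [benefitPoly, Polynomial.eval_sub, Polynomial.eval_mul, Polynomial.eval_C,
    Polynomial.eval_X, Polynomial.eval_one]
  generalize (partitionPoly p).eval x = S at *
  generalize (partitionPoly p).derivative.eval x = S1 at *
  generalize (partitionPoly p).derivative.derivative.eval x = S2 at *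
  have hS0 : S ≠ 0 := by positivity
  unfold socialRate
  split_ifs with h1
  · subst h1
    simp only [sub_self, zero_mul, one_pow, mul_one] at e1 e2
    have f0 : S = p + 2 := by linarith
    have f1 : S1 = (p + 2) * (p + 1) / 2 := by linarith
    subst f0 f1
    push_cast
    have : (p : ℝ) + 1 + 1 ≠ 0 := by positivity
    field_simp
    ring
  · have hy : 1 - x ≠ 0 := sub_ne_zero.2 (Ne.symm h1)
    have hu : 1 - x ^ (p + 2) ≠ 0 := by rw [← e0]; exact mul_ne_zero hy hS0
    rw [show p + 1 + 1 = p + 2 from rfl]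
    have f0 : S = (1 - x ^ (p + 2)) / (1 - x) := by field_simp; linarith
    have f1 : S1 = (S - (p + 2) * x ^ (p + 1)) / (1 - x) := by field_simp; linarith
    subst f1 f0
    have g1 : x ^ (p + 1) = x ^ p * x := pow_succ x p
    have g2 : x ^ (p + 2) = x ^ p * x ^ 2 := pow_add x p 2
    rw [g2] at hu
    rw [g1, g2]
    clear e0 e1 e2 hS hS0 g1 g2
    rw [mul_comm (x ^ p)] at hu
    generalize x ^ p = u at *
    push_cast
    field_simp
    ring

end Curvature

section Shape

variable {R C μ : ℝ} {p : ℕ}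

theorem continuousOn_socialRate_s6 (hC : 0 < C) :
    ContinuousOn (socialRate R C μ (p + 1)) (Set.Ici 0) := by
  refine ContinuousOn.congr (f := fun x => C *
      ((benefitPoly p (R * μ / C - (p + 2))).eval x / (partitionPoly p).eval x)) ?_
    fun x hx => socialRate_eq hC p hx
  refine continuousOn_const.mul (ContinuousOn.div (by fun_prop) (by fun_prop) fun x hx => ?_)
  have := one_le_partitionPoly_eval p (Set.mem_Ici.1 hx)
  positivity

theorem exists_deriv2_socialRate (hC : 0 < C) :
    ∃ f' f'' : ℝ → ℝ, ∀ x, 0 < x →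
      HasDerivAt (socialRate R C μ (p + 1)) (f' x) x ∧ HasDerivAt f' (f'' x) x ∧
      ∃ c, 0 < c ∧ f'' x = c * curvature p (R * μ / C - (p + 2)) x := by
  set A := benefitPoly p (R * μ / C - (p + 2)) with hA
  set S := partitionPoly p with hS
  refine ⟨fun x => C * ((A.derivative.eval x * S.eval x - A.eval x * S.derivative.eval x)
      / S.eval x ^ 2),
    fun x => C / (60 * S.eval x ^ 3) * curvature p (R * μ / C - (p + 2)) x, fun x hx => ?_⟩
  have hS1 : 1 ≤ S.eval x := one_le_partitionPoly_eval p hx.le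
  have hS0 : S.eval x ≠ 0 := by positivity
  refine ⟨?_, ?_, _, by positivity, rfl⟩
  · refine HasDerivAt.congr_of_eventuallyEq
      (((A.hasDerivAt x).div (S.hasDerivAt x) hS0).const_mul C) ?_
    filter_upwards [lt_mem_nhds hx] with y hy using socialRate_eq hC p hy.le
  · have h := (((((A.derivative.hasDerivAt x).mul (S.hasDerivAt x)).sub
      ((A.hasDerivAt x).mul (S.derivative.hasDerivAt x))).div ((S.hasDerivAt x).pow 2)
        (pow_ne_zero 2 hS0)).const_mul C)
    refine h.congr_deriv ?_
    simp only [Pi.sub_apply, Pi.mul_apply, Pi.pow_apply, ← curvature_eq, ← hA, ← hS]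
    field_simp
    ring

theorem concaveOn_socialRate (hC : 0 < C) {c : ℝ}
    (h : ∀ x, 0 < x → x < c → curvature p (R * μ / C - (p + 2)) x ≤ 0) :
    ConcaveOn ℝ (Set.Icc 0 c) (socialRate R C μ (p + 1)) := by
  obtain ⟨f', f'', hf⟩ := exists_deriv2_socialRate (R := R) (μ := μ) (p := p) hC
  refine concaveOn_of_hasDerivWithinAt2_nonpos (f' := f') (f'' := f'') (convex_Icc 0 c)
    ((continuousOn_socialRate_s6 hC).mono Set.Icc_subset_Ici_self) ?_ ?_ ?_ <;>
  · intro x hx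
    rw [interior_Icc] at hx
    obtain ⟨h1, h2, k, hk, e⟩ := hf x hx.1
    first
    | exact h1.hasDerivWithinAt
    | exact h2.hasDerivWithinAt
    | exact e ▸ mul_nonpos_of_nonneg_of_nonpos hk.le (h x hx.1 hx.2)

theorem convexOn_socialRate (hC : 0 < C) {c b : ℝ} (hc : 0 ≤ c)
    (h : ∀ x, c < x → x < b → 0 ≤ curvature p (R * μ / C - (p + 2)) x) :
    ConvexOn ℝ (Set.Icc c b) (socialRate R C μ (p + 1)) := by
  obtain ⟨f', f'', hf⟩ := exists_deriv2_socialRate (R := R) (μ := μ) (p := p) hC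
  refine convexOn_of_hasDerivWithinAt2_nonneg (f' := f') (f'' := f'') (convex_Icc c b)
    ((continuousOn_socialRate_s6 hC).mono fun x hx => hc.trans hx.1) ?_ ?_ ?_ <;>
  · intro x hx
    rw [interior_Icc] at hx
    obtain ⟨h1, h2, k, hk, e⟩ := hf x (hc.trans_lt hx.1)
    first
    | exact h1.hasDerivWithinAt
    | exact h2.hasDerivWithinAt
    | exact e ▸ mul_nonneg hk.le (h x hx.1 hx.2)

/-- The social benefit rate is concave up to some point beyond `1` and convex afterwards. -/
theorem exists_concaveOn_convexOn_socialRate (hC : 0 < C) (hRC : (p : ℝ) + 2 ≤ R * μ / C)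
    {m b : ℝ} (hm : 0 < m) (hm1 : m ≤ 1) (hmb : m < b) :
    ∃ c, m ≤ c ∧ c ≤ b ∧ ConcaveOn ℝ (Set.Icc 0 c) (socialRate R C μ (p + 1)) ∧
      ConvexOn ℝ (Set.Icc c b) (socialRate R C μ (p + 1)) := by
  have hs : 0 ≤ R * μ / C - (p + 2) := sub_nonneg.2 hRC
  set T : Set ℝ := {x | 0 < x ∧ x ≤ b ∧ curvature p (R * μ / C - (p + 2)) x ≤ 0} with hT
  have hmT : m ∈ T :=
    ⟨hm, hmb.le, curvature_nonpos_of_le hs hm hm1 (curvature_one_nonpos p hs)⟩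
  have hbdd : BddAbove T := ⟨b, fun x hx => hx.2.1⟩
  have hmc : m ≤ sSup T := le_csSup hbdd hmT
  refine ⟨sSup T, hmc, csSup_le ⟨m, hmT⟩ fun x hx => hx.2.1, concaveOn_socialRate hC ?_,
    convexOn_socialRate hC (hm.le.trans hmc) ?_⟩
  · intro x hx hxc
    obtain ⟨y, hy, hxy⟩ := exists_lt_of_lt_csSup ⟨m, hmT⟩ hxc
    exact curvature_nonpos_of_le hs hx hxy.le hy.2.2
  · intro x hx hxb
    by_contra! h
    exact absurd (le_csSup hbdd ⟨hm.trans_le (hmc.trans hx.le), hxb.le, h.le⟩) (not_le.2 hx)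

end Shape

theorem ConcaveOn.chord_le {f : ℝ → ℝ} {s : Set ℝ} (hf : ConcaveOn ℝ s f) {u v x : ℝ} (hu : u ∈ s)
    (hv : v ∈ s) (huv : u < v) (hux : u ≤ x) (hxv : x ≤ v) :
    f u * (v - x) + f v * (x - u) ≤ f x * (v - u) := by
  have hd : 0 < v - u := sub_pos.2 huv
  have h := hf.2 hu hv (div_nonneg (sub_nonneg.2 hxv) hd.le) (div_nonneg (sub_nonneg.2 hux) hd.le)
    (by field_simp; ring)
  have e : (v - x) / (v - u) * u + (x - u) / (v - u) * v = x := by field_simp; ring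
  simp only [smul_eq_mul] at h
  rw [e] at h
  have := mul_le_mul_of_nonneg_right h hd.le
  refine le_trans (le_of_eq ?_) this
  field_simp

/-- If `f` is concave and then convex, and its tangent at `b` lies above `f` at `m`, then the chord
from `m` to `b` lies below `f`. -/
theorem chord_le_of_concaveOn_convexOn {f : ℝ → ℝ} {c m b x f' : ℝ} (hmc : m ≤ c) (hcb : c ≤ b)
    (hmb : m < b) (hconc : ConcaveOn ℝ (Set.Icc m c) f) (hconv : ConvexOn ℝ (Set.Icc c b) f)
    (hf' : HasDerivAt f f' b) (htan : f m ≤ f b + f' * (m - b)) (hmx : m ≤ x) (hxb : x ≤ b) :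
    f m * (b - x) + f b * (x - m) ≤ f x * (b - m) := by
  have hright : ∀ y, c ≤ y → y ≤ b → f m * (b - y) + f b * (y - m) ≤ f y * (b - m) := by
    intro y hcy hyb
    rcases hyb.eq_or_lt with rfl | hyb
    · linarith
    have h := hconv.slope_le_of_hasDerivAt ⟨hcy, hyb.le⟩ ⟨hcb, le_rfl⟩ hyb hf'
    rw [slope_def_field, div_le_iff₀ (sub_pos.2 hyb)] at h
    nlinarith [mul_le_mul_of_nonneg_right htan (sub_nonneg.2 hyb.le),
      mul_le_mul_of_nonneg_right h (sub_nonneg.2 hmb.le)]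
  rcases le_total c x with hcx | hxc
  · exact hright x hcx hxb
  rcases hmc.eq_or_lt with rfl | hmc
  · exact hright x hmx hxb
  have h1 := hconc.chord_le ⟨le_rfl, hmc.le⟩ ⟨hmc.le, le_rfl⟩ hmc hmx hxc
  have h2 := hright c le_rfl hcb
  have h3 := mul_le_mul_of_nonneg_right h1 (sub_nonneg.2 hmb.le)
  have h4 := mul_le_mul_of_nonneg_right h2 (sub_nonneg.2 hmx)
  refine le_of_mul_le_mul_right ?_ (sub_pos.2 hmc)
  linarith

theorem integral_three_point {a b m p₁ p₂ p₃ : ℝ} (h₁ : 0 ≤ p₁) (h₂ : 0 ≤ p₂) (h₃ : 0 ≤ p₃)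
    (g : ℝ → ℝ) :
    ∫ ρ, g ρ ∂(ENNReal.ofReal p₁ • Measure.dirac a + ENNReal.ofReal p₂ • Measure.dirac m +
        ENNReal.ofReal p₃ • Measure.dirac b) = p₁ * g a + p₂ * g m + p₃ * g b := by
  have hi (q x : ℝ) : Integrable g (ENNReal.ofReal q • Measure.dirac x) :=
    (integrable_dirac (by simp)).smul_measure ENNReal.ofReal_ne_top
  rw [integral_add_measure ((hi _ _).add_measure (hi _ _)) (hi _ _),
    integral_add_measure (hi _ _) (hi _ _)]
  simp [integral_smul_measure, h₁, h₂, h₃]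

section Ambiguity

variable {a b m d : ℝ}

theorem three_point_mem_MADSet (ham : a < m) (hmb : m < b) (hd0 : 0 ≤ d)
    (hp₂ : 0 ≤ 1 - d / (2 * (m - a)) - d / (2 * (b - m))) :
    (ENNReal.ofReal (d / (2 * (m - a))) • Measure.dirac a +
      ENNReal.ofReal (1 - d / (2 * (m - a)) - d / (2 * (b - m))) • Measure.dirac m +
        ENNReal.ofReal (d / (2 * (b - m))) • Measure.dirac b : Measure ℝ) ∈ MADSet a b m d := by
  have h1 : 0 < m - a := sub_pos.2 ham
  have h3 : 0 < b - m := sub_pos.2 hmb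
  have hp₁ : 0 ≤ d / (2 * (m - a)) := by positivity
  have hp₃ : 0 ≤ d / (2 * (b - m)) := by positivity
  refine ⟨⟨?_⟩, ?_, ?_, ?_⟩
  · simp only [Measure.add_apply, Measure.smul_apply, measure_univ, smul_eq_mul, mul_one]
    rw [← ENNReal.ofReal_add hp₁ hp₂, ← ENNReal.ofReal_add (by positivity) hp₃,
      ENNReal.ofReal_eq_one]
    ring
  · simp [ham.le, hmb.le, (ham.trans hmb).le]
  · rw [integral_three_point hp₁ hp₂ hp₃ (fun x => x)]
    field_simp
    ring
  · rw [integral_three_point hp₁ hp₂ hp₃ (fun x => |x - m|), abs_of_neg (sub_neg.2 ham), sub_self,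
      abs_zero, abs_of_pos h3]
    field_simp
    ring

theorem le_integral_of_mem_MADSet {f : ℝ → ℝ} (ham : a < m) (hmb : m < b)
    (hf : ContinuousOn f (Set.Icc a b))
    (hleft : ∀ x, a ≤ x → x ≤ m → f a * (m - x) + f m * (x - a) ≤ f x * (m - a))
    (hright : ∀ x, m ≤ x → x ≤ b → f m * (b - x) + f b * (x - m) ≤ f x * (b - m))
    {P : Measure ℝ} (hP : P ∈ MADSet a b m d) :
    d / (2 * (m - a)) * f a + (1 - d / (2 * (m - a)) - d / (2 * (b - m))) * f m
      + d / (2 * (b - m)) * f b ≤ ∫ ρ, f ρ ∂P := by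
  obtain ⟨hprob, hsupp, hmean, hmad⟩ := hP
  have h1 : 0 < m - a := sub_pos.2 ham
  have h3 : 0 < b - m := sub_pos.2 hmb
  have hae : ∀ᵐ x ∂P, x ∈ Set.Icc a b := hsupp
  have hrestrict : P.restrict (Set.Icc a b) = P := Measure.restrict_eq_self_of_ae_mem hae
  have hint {g : ℝ → ℝ} (hg : ContinuousOn g (Set.Icc a b)) : Integrable g P := by
    have := hg.integrableOn_Icc (μ := P)
    rwa [IntegrableOn, hrestrict] at this
  set k₁ := (f m - f a) / (m - a) with hk₁
  set k₂ := (f b - f m) / (b - m) with hk₂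
  have hid : Integrable (fun x : ℝ => (k₁ + k₂) / 2 * (x - m)) P := hint (by fun_prop)
  have haff : Integrable (fun x : ℝ => f m + (k₁ + k₂) / 2 * (x - m)) P := hint (by fun_prop)
  have habs : Integrable (fun x : ℝ => (k₂ - k₁) / 2 * |x - m|) P := hint (by fun_prop)
  have hsub : ∫ x, (x - m) ∂P = 0 := by
    rw [integral_sub (f := fun x => x) (hint continuousOn_id) (integrable_const m), hmean]
    simp
  calc _ = ∫ x, (f m + (k₁ + k₂) / 2 * (x - m)) + (k₂ - k₁) / 2 * |x - m| ∂P := by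
        rw [integral_add haff habs,
          integral_add (integrable_const _) hid, integral_const_mul, integral_const_mul, hmad, hsub,
          hk₁, hk₂]
        simp
        field_simp
        ring
    _ ≤ ∫ x, f x ∂P := by
        refine integral_mono_ae (haff.add habs) (hint hf) ?_
        filter_upwards [hae] with x hx
        rcases le_total x m with hxm | hmx
        · rw [abs_of_nonpos (sub_nonpos.2 hxm)]
          have e : f m + (k₁ + k₂) / 2 * (x - m) + (k₂ - k₁) / 2 * -(x - m)
              = (f a * (m - x) + f m * (x - a)) / (m - a) := by
            rw [hk₁]; field_simp; ring
          rw [e, div_le_iff₀ h1]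
          exact hleft x hx.1 hxm
        · rw [abs_of_nonneg (sub_nonneg.2 hmx)]
          have e : f m + (k₁ + k₂) / 2 * (x - m) + (k₂ - k₁) / 2 * (x - m)
              = (f m * (b - x) + f b * (x - m)) / (b - m) := by
            rw [hk₂]; field_simp; ring
          rw [e, div_le_iff₀ h3]
          exact hright x hmx hx.2

end Ambiguity

/-- Case 1 of Proposition 3: if `f_n(b) + f_n'(b)(m-b) ≥ f_n(m)`, the worst-case
expected social benefit rate is attained by a three-point distribution on `{a, m, b}`. -/
theorem stmt6 (R C μ : ℝ) (hR : 0 < R) (hC : 0 < C) (hμ : 0 < μ)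
    (n : ℕ) (hn : 1 ≤ n) (hRC : (n : ℝ) + 1 ≤ R * μ / C)
    (a b m d : ℝ) (ha : 0 ≤ a) (ham : a < m) (hmb : m < b) (hm1 : m ≤ 1)
    (hd0 : 0 < d) (hd : d < 2 * (m - a) * (b - m) / (b - a))
    (hcase : socialRate R C μ n m ≤
      socialRate R C μ n b + deriv (socialRate R C μ n) b * (m - b)) :
    let p₁ : ℝ := d / (2 * (m - a))
    let p₃ : ℝ := d / (2 * (b - m))
    let p₂ : ℝ := 1 - p₁ - p₃
    let Pstar : Measure ℝ :=
      ENNReal.ofReal p₁ • Measure.dirac a + ENNReal.ofReal p₂ • Measure.dirac m +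
        ENNReal.ofReal p₃ • Measure.dirac b
    sInf ((fun P => ∫ ρ, socialRate R C μ n ρ ∂P) '' MADSet a b m d) =
      p₁ * socialRate R C μ n a + p₂ * socialRate R C μ n m + p₃ * socialRate R C μ n b ∧
    Pstar ∈ MADSet a b m d ∧
    (∫ ρ, socialRate R C μ n ρ ∂Pstar) =
      p₁ * socialRate R C μ n a + p₂ * socialRate R C μ n m + p₃ * socialRate R C μ n b := by

  intro p₁ p₃ p₂ Pstar
  obtain ⟨p, rfl⟩ := Nat.exists_eq_add_of_le' hn
  have hRC' : (p : ℝ) + 2 ≤ R * μ / C := by push_cast at hRC; linarith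
  have hm0 : 0 < m := ha.trans_lt ham
  obtain ⟨c, hmc, hcb, hconc, hconv⟩ :=
    exists_concaveOn_convexOn_socialRate (p := p) hC hRC' hm0 hm1 hmb
  obtain ⟨f', _, hf⟩ := exists_deriv2_socialRate (R := R) (μ := μ) (p := p) hC
  have hderiv := (hf b (hm0.trans hmb)).1
  rw [hderiv.deriv] at hcase
  have h1 : 0 < m - a := sub_pos.2 ham
  have h3 : 0 < b - m := sub_pos.2 hmb
  have hp₁ : 0 ≤ p₁ := by positivity
  have hp₃ : 0 ≤ p₃ := by positivity
  have hp₂ : 0 ≤ p₂ := by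
    have e : p₁ + p₃ = d * (b - a) / (2 * (m - a) * (b - m)) := by
      simp only [p₁, p₃]
      field_simp
      ring
    have : p₁ + p₃ ≤ 1 := by
      rw [e, div_le_one (by positivity)]
      exact ((lt_div_iff₀ (by linarith)).1 hd).le
    simp only [p₂]
    linarith
  have hmem : Pstar ∈ MADSet a b m d := three_point_mem_MADSet ham hmb hd0.le hp₂
  have hval := integral_three_point (a := a) (b := b) (m := m) hp₁ hp₂ hp₃
    (socialRate R C μ (p + 1))
  refine ⟨IsLeast.csInf_eq ⟨⟨Pstar, hmem, hval⟩, ?_⟩, hmem, hval⟩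
  rintro _ ⟨P, hP, rfl⟩
  refine le_integral_of_mem_MADSet ham hmb
    ((continuousOn_socialRate_s6 hC).mono fun x hx => ha.trans hx.1) (fun x hax hxm => ?_)
    (fun x hmx hxb => ?_) hP
  · exact hconc.chord_le ⟨ha, ham.le.trans hmc⟩ ⟨hm0.le, hmc⟩ ham hax hxm
  · exact chord_le_of_concaveOn_convexOn hmc hcb hmb
      (hconc.subset (Set.Icc_subset_Icc_left hm0.le) (convex_Icc m c)) hconv hderiv hcase hmx hxb
end
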